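/- arXiv:2301.13378 — 2 statements merged into one kernel-verified Lean document; each statement's English description precedes it below -/
import Mathlib

section
/- For the fractional Gaussian noise with Hurst index H ∈ (0,1), the sequence of prediction variances r(n) := det Σ_n(H) / det Σ_{n−1}(H) (with det Σ_0(H) := 1), which equals the conditional variance Var[G^H_n | G^H_1,…,G^H_{n−1}], is nonincreasing in n, and its limit σ²_inov(G^H) = lim_{n→∞} det Σ_n(H)/det Σ_{n−1}(H) satisfies σ²_inov(G^H) ≥ Γ(3/2 − H) / (Γ(H + 1/2) Γ(2 − 2H)). -/
open Real Matrix Filter Topology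

/-- Autocovariance of fractional Gaussian noise with Hurst index `H`. -/
noncomputable def fgnRho (H : ℝ) (k : ℕ) : ℝ :=
  if k = 0 then 1
  else (((k : ℝ) + 1) ^ (2 * H) - 2 * (k : ℝ) ^ (2 * H) + ((k : ℝ) - 1) ^ (2 * H)) / 2

/-- Covariance matrix of `n` consecutive values of fractional Gaussian noise. -/
noncomputable def fgnCov (H : ℝ) (n : ℕ) : Matrix (Fin n) (Fin n) ℝ :=
  Matrix.of fun i j => fgnRho H (Nat.dist i.val j.val)

/-- The lower bound `σ²_H = Γ(3/2 − H) / (Γ(H + 1/2) Γ(2 − 2H))`. -/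
noncomputable def fgnSigmaSq (H : ℝ) : ℝ :=
  Real.Gamma (3 / 2 - H) / (Real.Gamma (H + 1 / 2) * Real.Gamma (2 - 2 * H))

open MeasureTheory Set

lemma ofReal_rpow_mul_one_sub_rpow {x : ℝ} (a b : ℝ) (hx : x ∈ Ioc (0 : ℝ) 1) :
    (((x ^ (a - 1) * (1 - x) ^ (b - 1) : ℝ)) : ℂ) =
      (x : ℂ) ^ ((a : ℂ) - 1) * (1 - (x : ℂ)) ^ ((b : ℂ) - 1) := by
  rw [Complex.ofReal_mul, Complex.ofReal_cpow hx.1.le, Complex.ofReal_cpow (by linarith [hx.2])]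
  push_cast
  rfl

lemma intervalIntegrable_rpow_mul_one_sub_rpow {a b : ℝ} (ha : 0 < a) (hb : 0 < b) :
    IntervalIntegrable (fun x : ℝ => x ^ (a - 1) * (1 - x) ^ (b - 1)) volume 0 1 := by
  have h := Complex.betaIntegral_convergent (u := a) (v := b) (by simpa) (by simpa)
  rw [intervalIntegrable_iff_integrableOn_Ioc_of_le zero_le_one] at h ⊢
  refine (IntegrableOn.congr_fun h.re (fun x hx => ?_) measurableSet_Ioc)
  rw [← ofReal_rpow_mul_one_sub_rpow a b hx]
  exact Complex.ofReal_re _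

lemma integral_rpow_mul_one_sub_rpow {a b : ℝ} (ha : 0 < a) (hb : 0 < b) :
    ∫ x in (0 : ℝ)..1, x ^ (a - 1) * (1 - x) ^ (b - 1) = ProbabilityTheory.beta a b := by
  rw [ProbabilityTheory.beta_eq_betaIntegralReal a b ha hb, Complex.betaIntegral,
    ← Complex.ofReal_re (∫ x in (0 : ℝ)..1, _), ← intervalIntegral.integral_ofReal]
  congr 1
  refine intervalIntegral.integral_congr_ae (ae_of_all _ fun x hx => ?_)
  rw [uIoc_of_le zero_le_one] at hx
  exact ofReal_rpow_mul_one_sub_rpow a b hx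

/-- An antiderivative of `u ^ α * (1 + u) ^ (α - 2)`, as an incomplete beta integral. -/
noncomputable def betaPrimitive (α u : ℝ) : ℝ :=
  ∫ x in (0 : ℝ)..(u / (1 + u)), x ^ ((α + 1) - 1) * (1 - x) ^ ((1 - 2 * α) - 1)

lemma betaPrimitive_zero (α : ℝ) : betaPrimitive α 0 = 0 := by
  simp [betaPrimitive]

lemma continuousOn_integral_beta {α : ℝ} (h1 : -1 < 2 * α) (h2 : 2 * α < 1) :
    ContinuousOn (fun y : ℝ => ∫ x in (0 : ℝ)..y, x ^ ((α + 1) - 1) * (1 - x) ^ ((1 - 2 * α) - 1))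
      (Icc 0 1) := by
  have h := intervalIntegrable_rpow_mul_one_sub_rpow (a := α + 1) (b := 1 - 2 * α)
    (by linarith) (by linarith)
  have := intervalIntegral.continuousOn_primitive_interval' h (left_mem_uIcc)
  rwa [uIcc_of_le zero_le_one] at this

lemma hasDerivAt_betaPrimitive {α u : ℝ} (h1 : -1 < 2 * α) (h2 : 2 * α < 1) (hu : 0 < u) :
    HasDerivAt (betaPrimitive α) (u ^ α * (1 + u) ^ (α - 2)) u := by
  have hu1 : 0 < 1 + u := by linarith
  have hy0 : 0 < u / (1 + u) := by positivity
  have hy : 1 - u / (1 + u) = 1 / (1 + u) := by field_simp; ring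
  have hy1 : u / (1 + u) < 1 := by rw [div_lt_one hu1]; linarith
  have hint : IntervalIntegrable (fun x : ℝ => x ^ ((α + 1) - 1) * (1 - x) ^ ((1 - 2 * α) - 1))
      volume 0 (u / (1 + u)) :=
    (intervalIntegrable_rpow_mul_one_sub_rpow (a := α + 1) (b := 1 - 2 * α)
      (by linarith) (by linarith)).mono_set (by
        rw [uIcc_of_le hy0.le, uIcc_of_le zero_le_one]; exact Icc_subset_Icc le_rfl hy1.le)
  have hc : ∀ y ∈ Ioo (0 : ℝ) 1,
      ContinuousAt (fun x : ℝ => x ^ ((α + 1) - 1) * (1 - x) ^ ((1 - 2 * α) - 1)) y := by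
    intro y hy
    refine (continuousAt_id.rpow_const (Or.inl hy.1.ne')).mul
      ((continuousAt_const.sub continuousAt_id).rpow_const (Or.inl ?_))
    simpa using (sub_pos.2 hy.2).ne'
  have hd := intervalIntegral.integral_hasDerivAt_right hint
    (ContinuousOn.stronglyMeasurableAtFilter isOpen_Ioo
      (fun y hy => (hc y hy).continuousWithinAt) _ ⟨hy0, hy1⟩) (hc _ ⟨hy0, hy1⟩)
  have hq : HasDerivAt (fun u : ℝ => u / (1 + u)) (1 / (1 + u) ^ 2) u := by
    refine ((hasDerivAt_id' u).div ((hasDerivAt_id' u).const_add 1) hu1.ne').congr_deriv ?_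
    ring
  refine (hd.comp u hq).congr_deriv ?_
  rw [hy, one_div, Real.inv_rpow hu1.le, Real.div_rpow hu.le hu1.le, ← Real.rpow_neg hu1.le,
    show α + 1 - 1 = α by ring, div_eq_mul_inv, ← Real.rpow_neg hu1.le, one_div,
    ← Real.rpow_natCast, ← Real.rpow_neg hu1.le, mul_assoc, mul_assoc, ← Real.rpow_add hu1,
    ← Real.rpow_add hu1]
  congr 2
  push_cast
  ring

lemma tendsto_betaPrimitive {α : ℝ} (h1 : -1 < 2 * α) (h2 : 2 * α < 1) :
    Tendsto (betaPrimitive α) atTop (𝓝 (ProbabilityTheory.beta (α + 1) (1 - 2 * α))) := by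
  rw [← integral_rpow_mul_one_sub_rpow (by linarith) (by linarith)]
  refine ((continuousOn_integral_beta h1 h2) 1 (by simp)).tendsto.comp
    (tendsto_nhdsWithin_iff.2 ⟨?_, ?_⟩)
  · have : Tendsto (fun u : ℝ => 1 - (1 + u)⁻¹) atTop (𝓝 (1 - 0)) :=
      tendsto_const_nhds.sub (tendsto_inv_atTop_zero.comp (tendsto_atTop_add_const_left _ _ tendsto_id))
    rw [sub_zero] at this
    refine this.congr' ?_
    filter_upwards [eventually_gt_atTop 0] with u hu
    field_simp
    ring
  · filter_upwards [eventually_gt_atTop 0] with u hu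
    exact ⟨by positivity, by rw [div_le_one (by linarith)]; linarith⟩

lemma continuousWithinAt_betaPrimitive {α : ℝ} (h1 : -1 < 2 * α) (h2 : 2 * α < 1) :
    ContinuousWithinAt (betaPrimitive α) (Ici 0) 0 := by
  have h := (continuousOn_integral_beta h1 h2) (0 / (1 + 0)) (by simp)
  refine ContinuousWithinAt.comp (f := fun u : ℝ => u / (1 + u)) h ?_ ?_
  · exact (continuousAt_id.div (continuousAt_const.add continuousAt_id) (by simp)).continuousWithinAt
  · intro u (hu : 0 ≤ u)
    exact ⟨by positivity, by rw [div_le_one (by linarith)]; linarith⟩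

/-- The elementary part of the antiderivative of `(2α + 1) ((1 + u) ^ α - u ^ α) ^ 2`. -/
noncomputable def elemPrimitive (α u : ℝ) : ℝ :=
  (1 + u) ^ (2 * α + 1) + u ^ (2 * α + 1) - 2 * (u ^ (α + 1) * (1 + u) ^ α) -
    u ^ (α + 1) * (1 + u) ^ (α - 1)

lemma hasDerivAt_elemPrimitive (α : ℝ) {u : ℝ} (hu : 0 < u) :
    HasDerivAt (elemPrimitive α) ((2 * α + 1) * ((1 + u) ^ α - u ^ α) ^ 2 -
      (1 - α) * (u ^ α * (1 + u) ^ (α - 2))) u := by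
  have hu1 : 0 < 1 + u := by linarith
  have d0 : ∀ p : ℝ, HasDerivAt (fun u : ℝ => u ^ p) (p * u ^ (p - 1)) u := fun p =>
    Real.hasDerivAt_rpow_const (Or.inl hu.ne')
  have d1 : ∀ p : ℝ, HasDerivAt (fun u : ℝ => (1 + u) ^ p) (p * (1 + u) ^ (p - 1)) u := fun p => by
    simpa using ((hasDerivAt_id u).const_add 1).rpow_const (p := p) (Or.inl hu1.ne')
  have h := (((d1 (2 * α + 1)).add (d0 (2 * α + 1))).sub
    (((d0 (α + 1)).mul (d1 α)).const_mul 2)).sub ((d0 (α + 1)).mul (d1 (α - 1)))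
  refine h.congr_deriv ?_
  have e : ∀ {x : ℝ}, 0 < x → x ^ (2 * α) = x ^ α * x ^ α := fun hx => by
    rw [← Real.rpow_add hx]; ring_nf
  rw [show 2 * α + 1 - 1 = 2 * α by ring, show α + 1 - 1 = α by ring,
    show α - 1 - 1 = α - 2 by ring, e hu, e hu1, Real.rpow_sub hu1, Real.rpow_sub hu1,
    Real.rpow_add hu, Real.rpow_one, Real.rpow_one, show (2 : ℝ) = ((2 : ℕ) : ℝ) by norm_num,
    Real.rpow_natCast]
  push_cast
  field_simp
  ring

lemma elemPrimitive_zero {α : ℝ} (h1 : -1 < 2 * α) : elemPrimitive α 0 = 1 := by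
  simp [elemPrimitive, Real.zero_rpow (show 2 * α + 1 ≠ 0 by linarith),
    Real.zero_rpow (show α + 1 ≠ 0 by linarith)]

lemma continuousAt_elemPrimitive {α : ℝ} (h1 : -1 < 2 * α) : ContinuousAt (elemPrimitive α) 0 := by
  have c0 : ∀ p : ℝ, 0 < p → ContinuousAt (fun u : ℝ => u ^ p) 0 := fun p hp =>
    Real.continuousAt_rpow_const _ _ (Or.inr hp.le)
  have c1 : ∀ p : ℝ, ContinuousAt (fun u : ℝ => (1 + u) ^ p) 0 := fun p =>
    (continuousAt_const.add continuousAt_id).rpow_const (Or.inl (by simp))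
  exact ((((c1 _).add (c0 _ (by linarith))).sub
    (((c0 _ (by linarith)).mul (c1 _)).const_mul 2))).sub ((c0 _ (by linarith)).mul (c1 _))

/-- Completing the square in `elemPrimitive`. -/
lemma elemPrimitive_eq (α : ℝ) {u : ℝ} (hu : 0 < u) :
    elemPrimitive α u = ((1 + u) ^ (α + 1 / 2) - u ^ (α + 1 / 2)) ^ 2 +
      u ^ (α + 1 / 2) * (1 + u) ^ (α + 1 / 2) *
        (2 - √(u / (1 + u)) * (2 + 1 / (1 + u))) := by
  have hu1 : 0 < 1 + u := by linarith
  have e : ∀ {x : ℝ}, 0 < x → x ^ (2 * α + 1) = x ^ α * x ^ α * x := fun hx => by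
    rw [← Real.rpow_add hx, ← Real.rpow_add_one hx.ne']; ring_nf
  rw [elemPrimitive, e hu, e hu1, Real.rpow_add hu, Real.rpow_add hu1, Real.rpow_sub hu1,
    Real.rpow_add hu, Real.rpow_one, Real.rpow_one, Real.sqrt_div hu.le, ← Real.sqrt_eq_rpow,
    ← Real.sqrt_eq_rpow]
  have s0 := Real.sq_sqrt hu.le
  have s1 := Real.sq_sqrt hu1.le
  have p1 : 0 < √(1 + u) := Real.sqrt_pos.2 hu1
  generalize √(1 + u) = t at *
  generalize √u = s at *
  have : (1 + u) = t ^ 2 := s1.symm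
  rw [this]
  have : u = s ^ 2 := s0.symm
  generalize (t ^ 2) ^ α = q
  generalize u ^ α = p
  subst this
  field_simp
  ring

lemma two_sub_sqrt_bounds {u : ℝ} (hu : 0 < u) :
    0 ≤ 2 - √(u / (1 + u)) * (2 + 1 / (1 + u)) ∧
      2 - √(u / (1 + u)) * (2 + 1 / (1 + u)) ≤ 2 * (1 / (1 + u)) ^ 2 := by
  have hu1 : 0 < 1 + u := by linarith
  have hz0 : 0 < 1 / (1 + u) := by positivity
  have hz1 : 1 / (1 + u) < 1 := by rw [div_lt_one hu1]; linarith
  have hy : u / (1 + u) = 1 - 1 / (1 + u) := by field_simp; ring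
  rw [hy]
  generalize 1 / (1 + u) = z at *
  have s := Real.sq_sqrt (show 0 ≤ 1 - z by linarith)
  have s0 := Real.sqrt_nonneg (1 - z)
  generalize √(1 - z) = w at *
  have key : (w * (2 + z)) ^ 2 = 4 - 3 * z ^ 2 - z ^ 3 := by rw [mul_pow, s]; ring
  have hw : 0 ≤ w * (2 + z) := by positivity
  constructor
  · nlinarith [pow_pos hz0 3, pow_pos hz0 2]
  · nlinarith [pow_pos hz0 3, pow_pos hz0 2, mul_pos hz0 (sub_pos.2 hz1),
      mul_pos (pow_pos hz0 2) (sub_pos.2 hz1)]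

lemma tendsto_elemPrimitive {α : ℝ} (h1 : -1 < 2 * α) (h2 : 2 * α < 1) :
    Tendsto (elemPrimitive α) atTop (𝓝 0) := by
  have hu : Tendsto (fun u : ℝ => (u ^ (α - 1 / 2)) ^ 2 + 2 * (1 + u) ^ (2 * α - 1)) atTop
      (𝓝 (0 ^ 2 + 2 * 0)) := by
    refine Tendsto.add (Tendsto.pow ?_ 2) (Tendsto.const_mul _ ?_)
    · simpa using tendsto_rpow_neg_atTop (show 0 < 1 / 2 - α by linarith)
    · have := (tendsto_rpow_neg_atTop (show 0 < 1 - 2 * α by linarith)).comp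
        (tendsto_atTop_add_const_left atTop (1 : ℝ) tendsto_id)
      simpa [Function.comp_def] using this
  norm_num at hu
  refine squeeze_zero' ?_ ?_ hu
  · filter_upwards [eventually_gt_atTop 0] with u hu
    rw [elemPrimitive_eq α hu]
    have := (two_sub_sqrt_bounds hu).1
    positivity
  · filter_upwards [eventually_gt_atTop 0] with u hu
    have hu1 : 0 < 1 + u := by linarith
    rw [elemPrimitive_eq α hu]
    have hm : u ^ (α + 1 / 2) ≤ (1 + u) ^ (α + 1 / 2) :=
      Real.rpow_le_rpow hu.le (by linarith) (by linarith)
    refine add_le_add (pow_le_pow_left₀ (sub_nonneg.2 hm) ?_ 2) ?_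
    · have hb := rpow_one_add_le_one_add_mul_self (s := 1 / u) (p := α + 1 / 2)
        (by have : 0 < 1 / u := by positivity
            linarith) (by linarith) (by linarith)
      have hs : 1 + u = u * (1 + 1 / u) := by
        field_simp
        ring
      have hr : u ^ (α + 1 / 2) = u ^ (α - 1 / 2) * u := by
        rw [← Real.rpow_add_one hu.ne']; ring_nf
      rw [hs, Real.mul_rpow hu.le (by positivity), hr]
      have h0 : 0 ≤ u ^ (α - 1 / 2) := by positivity
      calc _ ≤ u ^ (α - 1 / 2) * u * (1 + (α + 1 / 2) * (1 / u)) - u ^ (α - 1 / 2) * u := by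
              gcongr
        _ = u ^ (α - 1 / 2) * (α + 1 / 2) := by field_simp; ring
        _ ≤ u ^ (α - 1 / 2) * 1 := by gcongr; linarith
        _ = _ := mul_one _
    · calc _ ≤ (1 + u) ^ (α + 1 / 2) * (1 + u) ^ (α + 1 / 2) * (2 * (1 / (1 + u)) ^ 2) := by
              gcongr
              · exact (two_sub_sqrt_bounds hu).1
              · exact (two_sub_sqrt_bounds hu).2
        _ = 2 * (1 + u) ^ (2 * α - 1) := by
              rw [← Real.rpow_add hu1, show 2 * α - 1 = α + 1 / 2 + (α + 1 / 2) - (2 : ℕ) by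
                push_cast; ring, Real.rpow_sub hu1, Real.rpow_natCast]
              field_simp
        _ = _ := by norm_num

lemma integral_sq_increment {α : ℝ} (h1 : -1 < 2 * α) (h2 : 2 * α < 1) :
    IntegrableOn (fun u : ℝ => (2 * α + 1) * ((1 + u) ^ α - u ^ α) ^ 2) (Ioi 0) ∧
    ∫ u in Ioi (0 : ℝ), (2 * α + 1) * ((1 + u) ^ α - u ^ α) ^ 2 =
      (1 - α) * ProbabilityTheory.beta (α + 1) (1 - 2 * α) - 1 := by
  have hd : ∀ u ∈ Ioi (0 : ℝ), HasDerivAt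
      (fun u => elemPrimitive α u + (1 - α) * betaPrimitive α u)
      ((2 * α + 1) * ((1 + u) ^ α - u ^ α) ^ 2) u := fun u hu =>
    ((hasDerivAt_elemPrimitive α hu).add
      ((hasDerivAt_betaPrimitive h1 h2 hu).const_mul (1 - α))).congr_deriv (by ring)
  have hc : ContinuousWithinAt (fun u => elemPrimitive α u + (1 - α) * betaPrimitive α u)
      (Ici 0) 0 :=
    (continuousAt_elemPrimitive h1).continuousWithinAt.add
      ((continuousWithinAt_betaPrimitive h1 h2).const_mul _)
  have ht := (tendsto_elemPrimitive h1 h2).add ((tendsto_betaPrimitive h1 h2).const_mul (1 - α))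
  have hp : ∀ u ∈ Ioi (0 : ℝ), 0 ≤ (2 * α + 1) * ((1 + u) ^ α - u ^ α) ^ 2 := fun u _ =>
    mul_nonneg (by linarith) (sq_nonneg _)
  refine ⟨integrableOn_Ioi_deriv_of_nonneg hc hd hp ht, ?_⟩
  rw [integral_Ioi_of_hasDerivAt_of_nonneg hc hd hp ht, elemPrimitive_zero h1, betaPrimitive_zero]
  ring

/-- The truncated power `(s - t)₊ ^ α`. -/
noncomputable def truncPow (α t s : ℝ) : ℝ := if t < s then (s - t) ^ α else 0

lemma truncPow_of_lt {α t s : ℝ} (h : t < s) : truncPow α t s = (s - t) ^ α := if_pos h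

lemma truncPow_of_le {α t s : ℝ} (h : s ≤ t) : truncPow α t s = 0 := if_neg h.not_gt

/-- The squared `L²` norm of the unit increment of the truncated power kernel. -/
noncomputable def kernelNormSq (α : ℝ) : ℝ := ∫ s, (truncPow α 0 s - truncPow α 1 s) ^ 2

lemma eqOn_unit_Ioc (α : ℝ) :
    EqOn (fun s => s ^ (2 * α)) (fun s => (truncPow α 0 s - truncPow α 1 s) ^ 2) (Ioc 0 1) := by
  intro s hs
  simp only [truncPow_of_lt hs.1, truncPow_of_le hs.2, sub_zero]
  rw [← Real.rpow_mul_natCast hs.1.le, mul_comm]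
  norm_num

lemma eqOn_unit_Ioi (α : ℝ) :
    EqOn (fun s => ((1 + (s + -1)) ^ α - (s + -1) ^ α) ^ 2)
      (fun s => (truncPow α 0 s - truncPow α 1 s) ^ 2) (Ioi 1) := by
  intro s (hs : 1 < s)
  simp only [truncPow_of_lt hs, truncPow_of_lt (zero_lt_one.trans hs)]
  ring_nf

lemma integrableOn_unit_Ioc {α : ℝ} (h1 : -1 < 2 * α) :
    IntegrableOn (fun s : ℝ => s ^ (2 * α)) (Ioc 0 1) :=
  (intervalIntegrable_iff_integrableOn_Ioc_of_le zero_le_one).1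
    (intervalIntegral.intervalIntegrable_rpow' h1)

lemma integral_unit_Ioc {α : ℝ} (h1 : -1 < 2 * α) :
    ∫ s in Ioc (0 : ℝ) 1, s ^ (2 * α) = 1 / (2 * α + 1) := by
  rw [← intervalIntegral.integral_of_le zero_le_one, integral_rpow (Or.inl h1)]
  simp [Real.zero_rpow (show 2 * α + 1 ≠ 0 by linarith)]

lemma integrableOn_unit_Ioi {α : ℝ} (h1 : -1 < 2 * α) (h2 : 2 * α < 1) :
    IntegrableOn (fun s : ℝ => ((1 + (s + -1)) ^ α - (s + -1) ^ α) ^ 2) (Ioi 1) := by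
  have h : IntegrableOn (fun u : ℝ => ((1 + u) ^ α - u ^ α) ^ 2) (Ioi 0) := by
    have := (integral_sq_increment h1 h2).1.const_mul (2 * α + 1)⁻¹
    simpa [IntegrableOn, inv_mul_cancel_left₀ (show 2 * α + 1 ≠ 0 by linarith)] using this
  have := ((measurePreserving_add_right volume (-1 : ℝ)).integrableOn_comp_preimage
    (measurableEmbedding_addRight (-1 : ℝ))).2 h
  simpa [Function.comp_def] using this

lemma integral_unit_Ioi {α : ℝ} (h1 : -1 < 2 * α) (h2 : 2 * α < 1) :
    ∫ s in Ioi (1 : ℝ), ((1 + (s + -1)) ^ α - (s + -1) ^ α) ^ 2 =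
      ((1 - α) * ProbabilityTheory.beta (α + 1) (1 - 2 * α) - 1) / (2 * α + 1) := by
  have hne : 2 * α + 1 ≠ 0 := by linarith
  have := (measurePreserving_add_right volume (-1 : ℝ)).setIntegral_preimage_emb
    (measurableEmbedding_addRight (-1 : ℝ)) (fun u : ℝ => ((1 + u) ^ α - u ^ α) ^ 2) (Ioi 0)
  rw [show (fun x : ℝ => x + -1) ⁻¹' Ioi 0 = Ioi 1 by ext; simp] at this
  rw [this, eq_div_iff hne, ← (integral_sq_increment h1 h2).2, integral_const_mul, mul_comm]

lemma support_unit (α : ℝ) {s : ℝ} (hs : s ∉ Ioi (0 : ℝ)) :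
    (truncPow α 0 s - truncPow α 1 s) ^ 2 = 0 := by
  have : s ≤ 0 := not_lt.1 hs
  simp [truncPow_of_le this, truncPow_of_le (this.trans zero_le_one)]

lemma integrable_unit {α : ℝ} (h1 : -1 < 2 * α) (h2 : 2 * α < 1) :
    Integrable (fun s => (truncPow α 0 s - truncPow α 1 s) ^ 2) := by
  refine (IntegrableOn.integrable_of_forall_notMem_eq_zero (s := Ioi 0) ?_
    fun s hs => support_unit α hs)
  rw [← Ioc_union_Ioi_eq_Ioi zero_le_one]
  exact ((integrableOn_unit_Ioc h1).congr_fun (eqOn_unit_Ioc α) measurableSet_Ioc).union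
    ((integrableOn_unit_Ioi h1 h2).congr_fun (eqOn_unit_Ioi α) measurableSet_Ioi)

lemma kernelNormSq_eq {α : ℝ} (h1 : -1 < 2 * α) (h2 : 2 * α < 1) :
    kernelNormSq α =
      (1 - α) * ProbabilityTheory.beta (α + 1) (1 - 2 * α) / (2 * α + 1) := by
  have hi := integrable_unit h1 h2
  rw [kernelNormSq, ← setIntegral_eq_integral_of_forall_compl_eq_zero
    (s := Ioi 0) (fun s hs => support_unit α hs), ← Ioc_union_Ioi_eq_Ioi zero_le_one,
    setIntegral_union (by simp) measurableSet_Ioi hi.integrableOn hi.integrableOn,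
    ← setIntegral_congr_fun measurableSet_Ioc (eqOn_unit_Ioc α),
    ← setIntegral_congr_fun measurableSet_Ioi (eqOn_unit_Ioi α),
    integral_unit_Ioc h1, integral_unit_Ioi h1 h2]
  ring

lemma sq_truncPow_sub_scale (α : ℝ) {a b : ℝ} (h : a < b) (s : ℝ) :
    (truncPow α a s - truncPow α b s) ^ 2 = (b - a) ^ (2 * α) *
      (truncPow α 0 ((b - a)⁻¹ * (s + -a)) - truncPow α 1 ((b - a)⁻¹ * (s + -a))) ^ 2 := by
  have hl : 0 < b - a := sub_pos.2 h
  have e : ∀ c : ℝ, truncPow α (a + (b - a) * c) s =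
      (b - a) ^ α * truncPow α c ((b - a)⁻¹ * (s + -a)) := by
    intro c
    have hs : s - (a + (b - a) * c) = (b - a) * ((b - a)⁻¹ * (s + -a) - c) := by
      field_simp
      ring
    rcases lt_or_ge c ((b - a)⁻¹ * (s + -a)) with hc | hc
    · have hp := mul_pos hl (sub_pos.2 hc)
      rw [truncPow_of_lt hc, truncPow_of_lt (by linarith), hs,
        Real.mul_rpow hl.le (sub_pos.2 hc).le]
    · have hp := mul_nonpos_of_nonneg_of_nonpos hl.le (sub_nonpos.2 hc)
      rw [truncPow_of_le hc, truncPow_of_le (by linarith), mul_zero]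
  have e0 := e 0
  have e1 := e 1
  rw [mul_zero, add_zero] at e0
  rw [mul_one, add_sub_cancel] at e1
  rw [e0, e1, ← mul_sub, mul_pow, ← Real.rpow_mul_natCast hl.le, mul_comm α]
  norm_num

lemma integrable_sq_truncPow_sub {α : ℝ} (h1 : -1 < 2 * α) (h2 : 2 * α < 1) (a b : ℝ) :
    Integrable (fun s => (truncPow α a s - truncPow α b s) ^ 2) := by
  wlog h : a < b generalizing a b
  · rcases (not_lt.1 h).eq_or_lt with rfl | h
    · simp
    · simpa only [sub_sq_comm] using this b a h
  simp_rw [sq_truncPow_sub_scale α h]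
  exact (((integrable_unit h1 h2).comp_mul_left' (inv_ne_zero (sub_pos.2 h).ne')).comp_add_right
    (-a)).const_mul _

lemma integral_sq_truncPow_sub {α : ℝ} (h1 : -1 < 2 * α) (a b : ℝ) :
    ∫ s, (truncPow α a s - truncPow α b s) ^ 2 = |a - b| ^ (2 * α + 1) * kernelNormSq α := by
  wlog h : a < b generalizing a b
  · rcases (not_lt.1 h).eq_or_lt with rfl | h
    · simp [Real.zero_rpow (show 2 * α + 1 ≠ 0 by linarith)]
    · simpa only [sub_sq_comm, abs_sub_comm] using this b a h
  have hl : 0 < b - a := sub_pos.2 h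
  simp_rw [sq_truncPow_sub_scale α h]
  rw [integral_const_mul, integral_add_right_eq_self (fun s => (truncPow α 0 ((b - a)⁻¹ * s) -
    truncPow α 1 ((b - a)⁻¹ * s)) ^ 2), Measure.integral_comp_mul_left
    (fun s => (truncPow α 0 s - truncPow α 1 s) ^ 2), abs_sub_comm, abs_of_pos hl,
    Real.rpow_add_one hl.ne', inv_inv, abs_of_pos hl, smul_eq_mul, mul_assoc]
  rfl

/-- The increment of the truncated power kernel over `[k, k + 1]`. -/
noncomputable def kernelIncr (α : ℝ) (k : ℕ) (s : ℝ) : ℝ :=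
  truncPow α k s - truncPow α (k + 1) s

lemma kernelIncr_mul (α : ℝ) (j k : ℕ) (s : ℝ) :
    kernelIncr α j s * kernelIncr α k s =
      ((truncPow α j s - truncPow α (k + 1) s) ^ 2 + (truncPow α (j + 1) s - truncPow α k s) ^ 2 -
        (truncPow α j s - truncPow α k s) ^ 2 -
        (truncPow α (j + 1) s - truncPow α (k + 1) s) ^ 2) / 2 := by
  rw [kernelIncr, kernelIncr]
  ring

lemma integrable_kernelIncr_mul {α : ℝ} (h1 : -1 < 2 * α) (h2 : 2 * α < 1) (j k : ℕ) :
    Integrable (fun s => kernelIncr α j s * kernelIncr α k s) := by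
  simp_rw [kernelIncr_mul]
  have h := integrable_sq_truncPow_sub h1 h2
  exact ((((h _ _).add (h _ _)).sub (h _ _)).sub (h _ _)).div_const 2

lemma integral_kernelIncr_mul {α : ℝ} (h1 : -1 < 2 * α) (h2 : 2 * α < 1) (j k : ℕ) :
    ∫ s, kernelIncr α j s * kernelIncr α k s =
      fgnRho (α + 1 / 2) (Nat.dist j k) * kernelNormSq α := by
  wlog hjk : j ≤ k generalizing j k
  · simpa only [mul_comm (kernelIncr α k _), Nat.dist_comm k] using this k j (le_of_not_ge hjk)
  obtain ⟨m, rfl⟩ := Nat.exists_eq_add_of_le hjk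
  have h := integrable_sq_truncPow_sub h1 h2
  have hH : 2 * (α + 1 / 2) = 2 * α + 1 := by ring
  simp_rw [kernelIncr_mul]
  have key : ∀ {f g p q : ℝ → ℝ}, Integrable f → Integrable g → Integrable p → Integrable q →
      ∫ s, (f s + g s - p s - q s) = (∫ s, f s) + (∫ s, g s) - (∫ s, p s) - ∫ s, q s :=
    fun hf hg hp hq => by
      rw [integral_sub ?_ hq, integral_sub ?_ hp, integral_add hf hg]
      · exact hf.add hg
      · exact (hf.add hg).sub hp
  rw [integral_div, key (h _ _) (h _ _) (h _ _) (h _ _)]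
  simp_rw [integral_sq_truncPow_sub h1]
  rw [Nat.dist_eq_sub_of_le hjk, Nat.add_sub_cancel_left, fgnRho, hH]
  push_cast
  rw [show (j : ℝ) - (j + m + 1) = -(m + 1) by ring, show (j : ℝ) + 1 - (j + m) = -(m - 1) by ring,
    show (j : ℝ) - (j + m) = -m by ring, show (j : ℝ) + 1 - (j + m + 1) = -m by ring]
  simp_rw [abs_neg]
  rw [abs_of_nonneg (show (0 : ℝ) ≤ m + 1 by positivity), Nat.abs_cast]
  split_ifs with hm
  · subst hm
    simp [Real.zero_rpow (show 2 * α + 1 ≠ 0 by linarith)]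
  · have : (1 : ℝ) ≤ m := by exact_mod_cast Nat.one_le_iff_ne_zero.2 hm
    rw [abs_of_nonneg (sub_nonneg.2 this)]
    ring

lemma fgnCov_apply (H : ℝ) {n : ℕ} (i j : Fin n) :
    fgnCov H n i j = fgnRho H (Nat.dist i j) := rfl

lemma fgnCov_isSymm (H : ℝ) (n : ℕ) : (fgnCov H n).IsSymm := by
  ext i j
  simp [fgnCov_apply, Nat.dist_comm]

lemma fgnCov_submatrix_succ (H : ℝ) (n : ℕ) :
    (fgnCov H (n + 1)).submatrix Fin.succ Fin.succ = fgnCov H n := by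
  ext i j
  simp [fgnCov_apply, Nat.dist_succ_succ]

lemma fgnCov_submatrix_castSucc (H : ℝ) (n : ℕ) :
    (fgnCov H (n + 1)).submatrix Fin.castSucc Fin.castSucc = fgnCov H n := rfl

/-- The covariance form of fractional Gaussian noise as a squared `L²` norm. -/
lemma fgnCov_quadratic_form {α : ℝ} (h1 : -1 < 2 * α) (h2 : 2 * α < 1) {n : ℕ} (v : Fin n → ℝ) :
    Integrable (fun s => (∑ i, v i * kernelIncr α i s) ^ 2) ∧
    ∫ s, (∑ i, v i * kernelIncr α i s) ^ 2 =
      (v ⬝ᵥ (fgnCov (α + 1 / 2) n *ᵥ v)) * kernelNormSq α := by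
  have e : ∀ s, (∑ i, v i * kernelIncr α i s) ^ 2 =
      ∑ i, ∑ j, v i * v j * (kernelIncr α i s * kernelIncr α j s) := fun s => by
    rw [sq, Finset.sum_mul_sum]
    refine Finset.sum_congr rfl fun i _ => Finset.sum_congr rfl fun j _ => by ring
  have hi : ∀ i j : Fin n, Integrable
      (fun s => v i * v j * (kernelIncr α i s * kernelIncr α j s)) := fun i j =>
    (integrable_kernelIncr_mul h1 h2 i j).const_mul _
  simp_rw [e]
  refine ⟨integrable_finsetSum _ fun i _ => integrable_finsetSum _ fun j _ => hi i j, ?_⟩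
  rw [integral_finsetSum _ fun i _ => integrable_finsetSum _ fun j _ => hi i j]
  simp_rw [integral_finsetSum _ fun j _ => hi _ j, integral_const_mul,
    integral_kernelIncr_mul h1 h2, dotProduct, mulVec, dotProduct, Finset.sum_mul, Finset.mul_sum,
    Finset.sum_mul, fgnCov_apply]
  refine Finset.sum_congr rfl fun i _ => Finset.sum_congr rfl fun j _ => by ring

lemma sum_kernelIncr_of_mem_Ioc (α : ℝ) {n : ℕ} (v : Fin (n + 1) → ℝ) {s : ℝ}
    (hs : s ∈ Ioc (0 : ℝ) 1) : (∑ i, v i * kernelIncr α i s) ^ 2 = v 0 ^ 2 * s ^ (2 * α) := by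
  have e : s ^ (2 * α) = _ := eqOn_unit_Ioc α hs
  rw [e, Fin.sum_univ_succ, Finset.sum_eq_zero, add_zero, mul_pow]
  · simp [kernelIncr]
  · intro i _
    have : (0 : ℝ) ≤ (i : ℕ) := Nat.cast_nonneg _
    rw [kernelIncr, truncPow_of_le, truncPow_of_le, sub_zero, mul_zero] <;>
    · rw [Fin.val_succ]
      push_cast
      linarith [hs.2]

lemma fgnSigmaSq_eq {α : ℝ} (h1 : -1 < 2 * α) (h2 : 2 * α < 1) :
    fgnSigmaSq (α + 1 / 2) = 1 / ((2 * α + 1) * kernelNormSq α) := by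
  rw [kernelNormSq_eq h1 h2, fgnSigmaSq, ProbabilityTheory.beta,
    show α + 1 + (1 - 2 * α) = (1 - α) + 1 by ring, Real.Gamma_add_one (s := 1 - α) (by linarith),
    show 3 / 2 - (α + 1 / 2) = 1 - α by ring, show α + 1 / 2 + 1 / 2 = α + 1 by ring,
    show 2 - 2 * (α + 1 / 2) = 1 - 2 * α by ring]
  have := (Real.Gamma_pos_of_pos (show 0 < 1 - α by linarith)).ne'
  have := (Real.Gamma_pos_of_pos (show 0 < α + 1 by linarith)).ne'
  have := (Real.Gamma_pos_of_pos (show 0 < 1 - 2 * α by linarith)).ne'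
  have : 2 * α + 1 ≠ 0 := by linarith
  have : 1 - α ≠ 0 := by linarith
  generalize Real.Gamma (1 - 2 * α) = g at *
  generalize 2 * α + 1 = c at *
  field_simp

lemma kernelNormSq_pos {α : ℝ} (h1 : -1 < 2 * α) (h2 : 2 * α < 1) : 0 < kernelNormSq α := by
  rw [kernelNormSq_eq h1 h2]
  have := ProbabilityTheory.beta_pos (show 0 < α + 1 by linarith) (show 0 < 1 - 2 * α by linarith)
  have : 0 < 2 * α + 1 := by linarith
  have : 0 < 1 - α := by linarith
  positivity

lemma fgnSigmaSq_pos {H : ℝ} (hH : H ∈ Ioo (0 : ℝ) 1) : 0 < fgnSigmaSq H := by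
  have := Real.Gamma_pos_of_pos (show 0 < 3 / 2 - H by linarith [hH.2])
  have := Real.Gamma_pos_of_pos (show 0 < H + 1 / 2 by linarith [hH.1])
  have := Real.Gamma_pos_of_pos (show 0 < 2 - 2 * H by linarith [hH.2])
  unfold fgnSigmaSq
  positivity

lemma fgnSigmaSq_mul_sq_le {H : ℝ} (hH : H ∈ Ioo (0 : ℝ) 1) {n : ℕ} (v : Fin (n + 1) → ℝ) :
    fgnSigmaSq H * v 0 ^ 2 ≤ v ⬝ᵥ (fgnCov H (n + 1) *ᵥ v) := by
  obtain ⟨α, rfl⟩ : ∃ α, H = α + 1 / 2 := ⟨H - 1 / 2, by ring⟩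
  have h1 : -1 < 2 * α := by linarith [hH.1]
  have h2 : 2 * α < 1 := by linarith [hH.2]
  have hV := kernelNormSq_pos h1 h2
  obtain ⟨hi, he⟩ := fgnCov_quadratic_form h1 h2 v
  have hle := setIntegral_le_integral (s := Ioc (0 : ℝ) 1) hi (ae_of_all _ fun s => sq_nonneg _)
  rw [he, setIntegral_congr_fun measurableSet_Ioc
    (fun s hs => sum_kernelIncr_of_mem_Ioc α v hs), integral_const_mul, integral_unit_Ioc h1] at hle
  rw [fgnSigmaSq_eq h1 h2, ← mul_le_mul_iff_left₀ hV]
  refine le_trans (le_of_eq ?_) hle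
  have : 2 * α + 1 ≠ 0 := by linarith
  field_simp

lemma fgnCov_posDef {H : ℝ} (hH : H ∈ Ioo (0 : ℝ) 1) (n : ℕ) : (fgnCov H n).PosDef := by
  refine posDef_iff_dotProduct_mulVec.2 ⟨by simpa [IsHermitian] using (fgnCov_isSymm H n).eq, ?_⟩
  induction n with
  | zero => exact fun x hx => (hx (Subsingleton.elim _ _)).elim
  | succ n ih =>
    intro x hx
    rw [star_trivial]
    by_cases h0 : x 0 = 0
    · have ht : Fin.tail x ≠ 0 := fun h => hx (by
        rw [← Fin.cons_self_tail x, h, h0]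
        ext i
        refine Fin.cases rfl (fun _ => rfl) i)
      have := ih ht
      rw [star_trivial, ← fgnCov_submatrix_succ] at this
      refine this.trans_eq ?_
      simp [dotProduct, mulVec, Fin.sum_univ_succ, h0, Fin.tail]
    · exact lt_of_lt_of_le (mul_pos (fgnSigmaSq_pos hH) (by positivity)) (fgnSigmaSq_mul_sq_le hH x)

/-- The optimal prediction error for the first coordinate given the others. -/
lemma Matrix.PosDef.exists_mulVec_eq_single {n : ℕ} {A : Matrix (Fin (n + 1)) (Fin (n + 1)) ℝ}
    (hA : A.PosDef) : ∃ v : Fin (n + 1) → ℝ, v 0 = 1 ∧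
      A *ᵥ v = Pi.single 0 (A.det / (A.submatrix Fin.succ Fin.succ).det) := by
  have hd := hA.det_pos
  have hd' := (hA.submatrix (Fin.succ_injective n)).det_pos
  refine ⟨A⁻¹ *ᵥ Pi.single 0 (A.det / (A.submatrix Fin.succ Fin.succ).det), ?_, ?_⟩
  · rw [mulVec_single, inv_def, Ring.inverse_eq_inv']
    simp only [col_apply, smul_apply, Pi.smul_apply, adjugate_fin_succ_eq_det_submatrix,
      Fin.succAbove_zero, MulOpposite.smul_eq_mul_unop, MulOpposite.unop_op, smul_eq_mul]
    field_simp
    simp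
  · rw [mulVec_mulVec, mul_nonsing_inv _ (isUnit_iff_ne_zero.2 hd.ne'), one_mulVec]

lemma Matrix.PosDef.det_div_det_le {n : ℕ} {A : Matrix (Fin (n + 1)) (Fin (n + 1)) ℝ}
    (hA : A.PosDef) {w : Fin (n + 1) → ℝ} (hw : w 0 = 1) :
    A.det / (A.submatrix Fin.succ Fin.succ).det ≤ w ⬝ᵥ (A *ᵥ w) := by
  obtain ⟨v, hv, hAv⟩ := hA.exists_mulVec_eq_single
  have h := hA.posSemidef.dotProduct_mulVec_nonneg (w - v)
  have hs : v ⬝ᵥ (A *ᵥ w) = w ⬝ᵥ (A *ᵥ v) := by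
    have : Aᵀ = A := by simpa [IsHermitian] using hA.isHermitian.eq
    rw [dotProduct_mulVec, ← mulVec_transpose, this, dotProduct_comm]
  rw [star_trivial, mulVec_sub, dotProduct_sub, sub_dotProduct, sub_dotProduct, hs, hAv,
    dotProduct_single, dotProduct_single, hw, hv] at h
  linarith

/-- The ratio of consecutive determinants is a prediction error variance. -/
lemma exists_fgnCov_form_eq {H : ℝ} (hH : H ∈ Ioo (0 : ℝ) 1) (n : ℕ) :
    ∃ v : Fin (n + 1) → ℝ, v 0 = 1 ∧
      v ⬝ᵥ (fgnCov H (n + 1) *ᵥ v) = (fgnCov H (n + 1)).det / (fgnCov H n).det := by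
  obtain ⟨v, hv, hAv⟩ := (fgnCov_posDef hH (n + 1)).exists_mulVec_eq_single
  exact ⟨v, hv, by rw [hAv, dotProduct_single, hv, one_mul, fgnCov_submatrix_succ]⟩

lemma fgnCov_det_ratio_antitone {H : ℝ} (hH : H ∈ Ioo (0 : ℝ) 1) :
    Antitone (fun n : ℕ => (fgnCov H (n + 1)).det / (fgnCov H n).det) := by
  refine antitone_nat_of_succ_le fun n => ?_
  obtain ⟨v, hv, he⟩ := exists_fgnCov_form_eq hH n
  have h := (fgnCov_posDef hH (n + 2)).det_div_det_le
    (w := Fin.snoc (α := fun _ => ℝ) v 0) (by simpa using hv)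
  rw [fgnCov_submatrix_succ] at h
  refine h.trans_eq ?_
  rw [← he, ← fgnCov_submatrix_castSucc H (n + 1)]
  simp [dotProduct, mulVec, Fin.sum_univ_castSucc (n := n + 1)]

/-- The sequence of prediction variances `r(n) = det Σ_n(H) / det Σ_{n−1}(H)`
is nonincreasing, and its limit (the innovation variance) is at least `σ²_H`. -/
theorem fgn_innovation_variance_lower_bound (H : ℝ) (hH : H ∈ Set.Ioo (0 : ℝ) 1) :
    Antitone (fun n : ℕ => (fgnCov H (n + 1)).det / (fgnCov H n).det) ∧
    ∃ L : ℝ,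
      Filter.Tendsto (fun n : ℕ => (fgnCov H (n + 1)).det / (fgnCov H n).det)
        Filter.atTop (nhds L) ∧ fgnSigmaSq H ≤ L := by
  have hle : ∀ n : ℕ, fgnSigmaSq H ≤ (fgnCov H (n + 1)).det / (fgnCov H n).det := fun n => by
    obtain ⟨v, hv, he⟩ := exists_fgnCov_form_eq hH n
    simpa [hv, he] using fgnSigmaSq_mul_sq_le hH v
  exact ⟨fgnCov_det_ratio_antitone hH, _,
    tendsto_atTop_ciInf (fgnCov_det_ratio_antitone hH) ⟨_, forall_mem_range.2 hle⟩, le_ciInf hle⟩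
end

section
/- For the fractional Gaussian noise with Hurst index H ∈ (0,1), the limit lim_{n→∞} (1/n) log det Σ_n(H) equals log( sin(πH) Γ(2H+1) ) − (2H+1) log(2π) + ∫_{−1/2}^{1/2} log( Σ_{k∈ℤ} |μ + k|^{−2H−1} ) dμ; equivalently, the entropy rate satisfies H_∞(G^H) = (1/2)(1 + log( sin(πH) Γ(2H+1) (2π)^{−2H} )) + (1/2) ∫_{−1/2}^{1/2} log( Σ_{k∈ℤ} |μ + k|^{−2H−1} ) dμ. -/
open Real Matrix Filter Topology intervalIntegral

/-- For a positive definite real matrix, `log det A ≤ tr A - n`. -/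
theorem Matrix.PosDef.log_det_le_trace_sub_card {n : Type*} [Fintype n] [DecidableEq n]
    {A : Matrix n n ℝ} (hA : A.PosDef) : Real.log A.det ≤ A.trace - Fintype.card n := by
  have h1 : A.det = ∏ i, hA.1.eigenvalues i := by
    simpa using hA.1.det_eq_prod_eigenvalues
  have h2 : A.trace = ∑ i, hA.1.eigenvalues i := by
    simpa using hA.1.trace_eq_sum_eigenvalues
  rw [h1, h2, Real.log_prod (fun i _ => (hA.eigenvalues_pos i).ne')]
  have h3 : ∑ i, Real.log (hA.1.eigenvalues i) ≤ ∑ i, (hA.1.eigenvalues i - 1) :=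
    Finset.sum_le_sum fun i _ => Real.log_le_sub_one_of_pos (hA.eigenvalues_pos i)
  simpa using h3

/-- The variational bound `log det T ≤ tr (T S) - n - log det S` for positive definite matrices. -/
theorem Matrix.PosDef.log_det_le_trace_mul_sub {n : Type*} [Fintype n] [DecidableEq n]
    {T S : Matrix n n ℝ} (hT : T.PosDef) (hS : S.PosDef) :
    Real.log T.det ≤ (T * S).trace - Fintype.card n - Real.log S.det := by
  obtain ⟨B, hB⟩ : ∃ B : Matrix n n ℝ, S = Bᴴ * B := by
    open scoped MatrixOrder in
    exact CStarAlgebra.nonneg_iff_eq_star_mul_self.mp hS.posSemidef.nonneg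
  have hdet : S.det = B.det ^ 2 := by
    rw [hB, Matrix.det_mul, Matrix.det_conjTranspose]; simp [sq]
  have hB0 : B.det ≠ 0 := by
    intro h; have := hS.det_pos; rw [hdet, h] at this; simp at this
  have hBu : IsUnit B := (Matrix.isUnit_iff_isUnit_det B).2 hB0.isUnit
  have hP : (B * T * Bᴴ).PosDef :=
    hT.mul_mul_conjTranspose_same (Matrix.vecMul_injective_of_isUnit hBu)
  have h1 := hP.log_det_le_trace_sub_card
  have h2 : (B * T * Bᴴ).trace = (T * S).trace := by
    rw [hB, Matrix.mul_assoc, Matrix.trace_mul_comm, Matrix.mul_assoc]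
  have h3 : (B * T * Bᴴ).det = T.det * S.det := by
    rw [hdet, Matrix.det_mul, Matrix.det_mul, Matrix.det_conjTranspose]
    simp only [star_trivial]; ring
  rw [h2, h3, Real.log_mul hT.det_pos.ne' hS.det_pos.ne'] at h1
  linarith

/-- The ratio of consecutive leading principal minors is the value of the quadratic form at a
vector whose last coordinate is one. -/
theorem Matrix.exists_dotProduct_mulVec_eq_det_div {n : ℕ}
    (A : Matrix (Fin (n + 1)) (Fin (n + 1)) ℝ)
    (h : (A.submatrix Fin.castSucc Fin.castSucc).det ≠ 0) :
    ∃ v : Fin (n + 1) → ℝ, v (Fin.last n) = 1 ∧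
      v ⬝ᵥ (A *ᵥ v) = A.det / (A.submatrix Fin.castSucc Fin.castSucc).det := by
  set d := (A.submatrix Fin.castSucc Fin.castSucc).det
  have hadj : A.adjugate (Fin.last n) (Fin.last n) = d := by
    rw [Matrix.adjugate_fin_succ_eq_det_submatrix]
    simp [← two_mul, pow_mul, Fin.succAbove_last, d]
  have hmul : A *ᵥ (fun i => A.adjugate i (Fin.last n)) = Pi.single (Fin.last n) A.det := by
    ext i
    have := congrFun (congrFun (Matrix.mul_adjugate A) i) (Fin.last n)
    rw [Matrix.mul_apply] at this
    simp only [Matrix.mulVec, dotProduct, this]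
    by_cases hi : i = Fin.last n
    · subst hi; simp
    · simp [hi]
  refine ⟨fun i => d⁻¹ * A.adjugate i (Fin.last n), by simp [hadj, h], ?_⟩
  have hv : (fun i => d⁻¹ * A.adjugate i (Fin.last n))
      = d⁻¹ • (fun i => A.adjugate i (Fin.last n)) := by ext; simp
  rw [hv, Matrix.mulVec_smul, hmul]
  simp [hadj, h]
  field_simp

section Szego

open MeasureTheory

/-- The `n × n` real symmetric Toeplitz matrix of cosine coefficients of a symbol on the circle. -/
noncomputable def circleToeplitz (f : UnitAddCircle → ℝ) (n : ℕ) : Matrix (Fin n) (Fin n) ℝ :=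
  Matrix.of fun i j => ∫ x, f x * (fourier ((i : ℤ) - (j : ℤ)) x : ℂ).re

/-- The polynomial with prescribed real coefficients, viewed over `ℂ`. -/
noncomputable def coeffPolynomial {n : ℕ} (v : Fin n → ℝ) : Polynomial ℂ :=
  ∑ j : Fin n, Polynomial.monomial (j : ℕ) (v j : ℂ)

theorem coeffPolynomial_coeff {n : ℕ} (v : Fin n → ℝ) (j : Fin n) :
    (coeffPolynomial v).coeff j = v j := by
  simp [coeffPolynomial, Polynomial.finsetSum_coeff, Polynomial.coeff_monomial, Fin.val_inj]

theorem coeffPolynomial_degree_lt {n : ℕ} (v : Fin n → ℝ) :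
    (coeffPolynomial v).degree < n := by
  rw [Polynomial.degree_lt_iff_coeff_zero]
  intro m hm
  simp only [coeffPolynomial, Polynomial.finsetSum_coeff, Polynomial.coeff_monomial]
  exact Finset.sum_eq_zero fun j _ => if_neg (by have := j.2; omega)

theorem coeffPolynomial_ne_zero {n : ℕ} {v : Fin n → ℝ} (hv : v ≠ 0) : coeffPolynomial v ≠ 0 := by
  contrapose! hv
  ext j
  have := coeffPolynomial_coeff v j
  rw [hv] at this
  simpa using this.symm

theorem coeffPolynomial_leadingCoeff {n : ℕ} {v : Fin (n + 1) → ℝ} (hv : v (Fin.last n) = 1) :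
    (coeffPolynomial v).leadingCoeff = 1 := by
  have hc : (coeffPolynomial v).coeff n = 1 := by
    have := coeffPolynomial_coeff v (Fin.last n)
    simpa [hv] using this
  have hd : (coeffPolynomial v).natDegree = n := by
    apply le_antisymm
    · have := coeffPolynomial_degree_lt v
      exact Nat.lt_succ_iff.1 ((Polynomial.natDegree_lt_iff_degree_lt
        (fun h => by simp [h] at hc)).2 this)
    · exact Polynomial.le_natDegree_of_ne_zero (by simp [hc])
  rw [Polynomial.leadingCoeff, hd, hc]

theorem norm_sq_eval_coeffPolynomial {n : ℕ} (v : Fin n → ℝ) (x : UnitAddCircle) :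
    ‖(coeffPolynomial v).eval (fourier 1 x : ℂ)‖ ^ 2
      = ∑ i, ∑ j, v i * v j * (fourier ((i : ℤ) - (j : ℤ)) x : ℂ).re := by
  have hpow : ∀ j : ℕ, (fourier 1 x : ℂ) ^ j = fourier (j : ℤ) x := by
    intro j
    induction j with
    | zero => simp
    | succ k ih => rw [pow_succ, ih]; push_cast; rw [fourier_add]
  have he : (coeffPolynomial v).eval (fourier 1 x : ℂ) = ∑ j : Fin n, (v j : ℂ) * fourier (j : ℤ) x := by
    simp only [coeffPolynomial, Polynomial.eval_finsetSum, Polynomial.eval_monomial, hpow]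
  have h2 : ((‖(coeffPolynomial v).eval (fourier 1 x : ℂ)‖ ^ 2 : ℝ) : ℂ)
      = ∑ i : Fin n, ∑ j : Fin n, (v i : ℂ) * v j * fourier ((i : ℤ) - (j : ℤ)) x := by
    push_cast
    rw [← Complex.mul_conj', he, map_sum, Finset.sum_mul_sum]
    refine Finset.sum_congr rfl fun i _ => Finset.sum_congr rfl fun j _ => ?_
    rw [sub_eq_add_neg, fourier_add, fourier_neg, map_mul, Complex.conj_ofReal]
    ring
  have h3 := congrArg Complex.re h2
  rw [Complex.ofReal_re] at h3
  rw [h3, Complex.re_sum]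
  refine Finset.sum_congr rfl fun i _ => ?_
  rw [Complex.re_sum]
  refine Finset.sum_congr rfl fun j _ => ?_
  rw [← Complex.ofReal_mul, Complex.re_ofReal_mul]

theorem integrable_mul_re_fourier {f : UnitAddCircle → ℝ} (hf : Integrable f) (k : ℤ) :
    Integrable fun x => f x * (fourier k x : ℂ).re := by
  refine hf.mul_bdd (c := 1) ?_ ?_
  · exact (Complex.continuous_re.comp (fourier k).continuous).aestronglyMeasurable
  · refine Filter.Eventually.of_forall fun x => ?_
    exact (Complex.abs_re_le_norm _).trans
      (((fourier k).norm_coe_le_norm x).trans_eq (fourier_norm k))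

theorem integrable_mul_norm_sq_eval {f : UnitAddCircle → ℝ} (hf : Integrable f) {n : ℕ}
    (v : Fin n → ℝ) :
    Integrable fun x => f x * ‖(coeffPolynomial v).eval (fourier 1 x : ℂ)‖ ^ 2 := by
  simp only [norm_sq_eval_coeffPolynomial, Finset.mul_sum]
  refine integrable_finsetSum _ fun i _ => integrable_finsetSum _ fun j _ => ?_
  have := (integrable_mul_re_fourier hf ((i : ℤ) - (j : ℤ))).const_mul (v i * v j)
  refine this.congr (Filter.Eventually.of_forall fun x => ?_)
  simp only []; ring

theorem dotProduct_circleToeplitz {f : UnitAddCircle → ℝ} (hf : Integrable f) {n : ℕ}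
    (v : Fin n → ℝ) :
    v ⬝ᵥ (circleToeplitz f n *ᵥ v)
      = ∫ x, f x * ‖(coeffPolynomial v).eval (fourier 1 x : ℂ)‖ ^ 2 := by
  have hI : ∀ i j : Fin n,
      Integrable fun x => f x * (v i * v j * (fourier ((i : ℤ) - (j : ℤ)) x : ℂ).re) := by
    intro i j
    have := (integrable_mul_re_fourier hf ((i : ℤ) - (j : ℤ))).const_mul (v i * v j)
    refine this.congr (Filter.Eventually.of_forall fun x => ?_)
    simp only []; ring
  simp only [norm_sq_eval_coeffPolynomial, Finset.mul_sum]
  rw [integral_finsetSum _ fun i _ => integrable_finsetSum _ fun j _ => hI i j]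
  simp only [dotProduct, Matrix.mulVec, Finset.mul_sum]
  refine Finset.sum_congr rfl fun i _ => ?_
  rw [integral_finsetSum _ fun j _ => hI i j]
  refine Finset.sum_congr rfl fun j _ => ?_
  simp only [circleToeplitz, Matrix.of_apply]
  rw [← MeasureTheory.integral_mul_const, ← MeasureTheory.integral_const_mul]
  congr 1; ext x; ring

theorem circleToeplitz_isHermitian (f : UnitAddCircle → ℝ) (n : ℕ) :
    (circleToeplitz f n).IsHermitian := by
  ext i j
  simp only [Matrix.conjTranspose_apply, circleToeplitz, Matrix.of_apply, star_trivial]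
  congr 1; ext x
  rw [← neg_sub, fourier_neg, Complex.conj_re]

theorem integrable_unitAddCircle_iff {E : Type*} [NormedAddCommGroup E] (t : ℝ)
    {g : UnitAddCircle → E} :
    Integrable g ↔ IntervalIntegrable (fun x : ℝ => g x) volume t (t + 1) := by
  rw [intervalIntegrable_iff_integrableOn_Ioc_of_le (by linarith)]
  have h1 := measurePreserving_subtype_coe (μa := (volume : Measure ℝ))
    (measurableSet_Ioc (a := t) (b := t + 1))
  have h2 := AddCircle.measurePreserving_equivIoc (T := 1) (a := t)
  have h3 := h2.integrable_comp_emb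
    (AddCircle.measurableEquivIoc (T := 1) t).measurableEmbedding
    (g := fun y : Set.Ioc t (t + 1) => g ((y : ℝ) : UnitAddCircle))
  have h4 : ((fun y : Set.Ioc t (t + 1) => g ((y : ℝ) : UnitAddCircle))
      ∘ (AddCircle.equivIoc (1 : ℝ) t)) = g := by
    ext x
    simp only [Function.comp]
    congr 1
    exact (AddCircle.equivIoc (1 : ℝ) t).symm_apply_apply x
  rw [h4] at h3
  rw [h3]
  exact h1.integrable_comp_emb (MeasurableEmbedding.subtype_coe measurableSet_Ioc)
    (g := fun x : ℝ => g x)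

instance : NullSingletonClass (volume : Measure UnitAddCircle) where
  measure_singleton x := by
    rw [← (UnitAddCircle.measurePreserving_mk 0).measure_preimage
      (measurableSet_singleton x).nullMeasurableSet,
      Measure.restrict_apply ((AddCircle.measurable_mk') (measurableSet_singleton x))]
    refine Set.Subsingleton.measure_zero ?_ _
    rintro a ⟨ha, ha'⟩ b ⟨hb, hb'⟩
    have hab : (a : UnitAddCircle) = b := Eq.trans ha hb.symm
    exact (AddCircle.coe_eq_coe_iff_of_mem_Ioc (p := (1 : ℝ)) ha' hb').1 hab

theorem circleMap_eq_fourier (x : ℝ) :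
    circleMap 0 1 (2 * π * x) = (fourier 1 (x : UnitAddCircle) : ℂ) := by
  rw [fourier_coe_apply, circleMap]
  push_cast
  simp only [zero_add, one_mul, mul_one, div_one]
  congr 1; ring

theorem integrable_log_norm_eval (p : Polynomial ℂ) :
    Integrable fun x : UnitAddCircle => Real.log ‖p.eval (fourier 1 x : ℂ)‖ := by
  rw [integrable_unitAddCircle_iff 0]
  have h := p.intervalIntegrable_mahlerMeasure.comp_mul_left (c := 2 * π)
  simp only [circleMap_eq_fourier] at h
  simpa [Real.pi_ne_zero] using h

theorem integral_log_norm_eval (p : Polynomial ℂ) :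
    ∫ x : UnitAddCircle, Real.log ‖p.eval (fourier 1 x : ℂ)‖ = p.logMahlerMeasure := by
  rw [← UnitAddCircle.intervalIntegral_preimage 0, Polynomial.logMahlerMeasure_def,
    Real.circleAverage_def]
  have h := intervalIntegral.integral_comp_mul_left (a := 0) (b := 1) (c := 2 * π)
    (fun θ => Real.log ‖p.eval (circleMap 0 1 θ)‖) (by positivity)
  simp only [circleMap_eq_fourier] at h
  simpa using h

/-- Jensen's inequality for `∫ f |p|²` on the circle. -/
theorem exp_le_integral_mul_norm_sq {f : UnitAddCircle → ℝ} (hpos : ∀ᵐ x, 0 < f x)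
    (hlog : Integrable fun x => Real.log (f x)) {p : Polynomial ℂ} (hp : p ≠ 0)
    (hfp : Integrable fun x => f x * ‖p.eval (fourier 1 x : ℂ)‖ ^ 2) :
    Real.exp (2 * p.logMahlerMeasure + ∫ x, Real.log (f x))
      ≤ ∫ x, f x * ‖p.eval (fourier 1 x : ℂ)‖ ^ 2 := by
  set c := 2 * p.logMahlerMeasure + ∫ x, Real.log (f x) with hc
  have hl := integrable_log_norm_eval p
  have hne : ∀ᵐ x : UnitAddCircle, p.eval (fourier 1 x : ℂ) ≠ 0 := by
    have hfin : ((fun x : UnitAddCircle => (fourier 1 x : ℂ)) ⁻¹' (p.roots.toFinset : Set ℂ)).Finite := by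
      refine Set.Finite.preimage (Function.Injective.injOn ?_) (Finset.finite_toSet _)
      intro x y hxy
      simp only [fourier_one] at hxy
      exact AddCircle.injective_toCircle one_ne_zero (Subtype.ext hxy)
    have := (Set.Finite.countable hfin).measure_zero (volume : Measure UnitAddCircle)
    rw [ae_iff]
    refine measure_mono_null ?_ this
    intro x hx
    simp only [ne_eq, not_not, Set.mem_ofPred_eq] at hx
    simpa [hp] using hx
  set L : UnitAddCircle → ℝ := fun x => Real.log (f x) + 2 * Real.log ‖p.eval (fourier 1 x : ℂ)‖
  have hLi : Integrable L := hlog.add (hl.const_mul 2)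
  have hL : ∫ x, L x = c := by
    rw [MeasureTheory.integral_add hlog (hl.const_mul 2), MeasureTheory.integral_const_mul,
      integral_log_norm_eval, hc]
    ring
  have hle : ∫ x, Real.exp c * (1 + L x - c)
      ≤ ∫ x, f x * ‖p.eval (fourier 1 x : ℂ)‖ ^ 2 := by
    refine integral_mono_ae (((integrable_const _).add hLi |>.sub (integrable_const _)).const_mul _)
      hfp ?_
    filter_upwards [hpos, hne] with x hx hx'
    have hx2 : 0 < ‖p.eval (fourier 1 x : ℂ)‖ := norm_pos_iff.2 hx'
    have h1 : f x * ‖p.eval (fourier 1 x : ℂ)‖ ^ 2 = Real.exp c * Real.exp (L x - c) := by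
      rw [← Real.exp_add, add_sub_cancel, Real.exp_add, Real.exp_log hx, two_mul, Real.exp_add,
        Real.exp_log hx2, sq]
    rw [h1]
    refine mul_le_mul_of_nonneg_left ?_ (Real.exp_pos c).le
    have := Real.add_one_le_exp (L x - c)
    linarith
  refine le_trans (le_of_eq ?_) hle
  have h1 : ∫ x, (1 + L x - c) = 1 := by
    rw [MeasureTheory.integral_sub (f := fun x => 1 + L x) ((integrable_const _).add hLi)
      (integrable_const _), MeasureTheory.integral_add (integrable_const _) hLi, hL]
    simp [measureReal_def]
  rw [MeasureTheory.integral_const_mul, h1, mul_one]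

theorem circleToeplitz_posDef {f : UnitAddCircle → ℝ} (hf : Integrable f) (hpos : ∀ᵐ x, 0 < f x)
    (hlog : Integrable fun x => Real.log (f x)) (n : ℕ) : (circleToeplitz f n).PosDef := by
  refine Matrix.PosDef.of_dotProduct_mulVec_pos (circleToeplitz_isHermitian f n) fun v hv => ?_
  rw [star_trivial, dotProduct_circleToeplitz hf]
  exact (Real.exp_pos _).trans_le (exp_le_integral_mul_norm_sq hpos hlog (coeffPolynomial_ne_zero hv)
    (integrable_mul_norm_sq_eval hf v))

/-- The lower Szegő bound, valid for every `n`. -/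
theorem nat_mul_integral_log_le_log_det_circleToeplitz {f : UnitAddCircle → ℝ} (hf : Integrable f)
    (hpos : ∀ᵐ x, 0 < f x) (hlog : Integrable fun x => Real.log (f x)) (n : ℕ) :
    n * ∫ x, Real.log (f x) ≤ Real.log (circleToeplitz f n).det := by
  induction n with
  | zero => simp
  | succ n ih =>
    have hsub : (circleToeplitz f (n + 1)).submatrix Fin.castSucc Fin.castSucc
        = circleToeplitz f n := by
      ext i j; simp [circleToeplitz]
    have hd := (circleToeplitz_posDef hf hpos hlog n).det_pos
    have hd' := (circleToeplitz_posDef hf hpos hlog (n + 1)).det_pos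
    obtain ⟨v, hv, hq⟩ := (circleToeplitz f (n + 1)).exists_dotProduct_mulVec_eq_det_div
      (by rw [hsub]; exact hd.ne')
    rw [hsub, dotProduct_circleToeplitz hf] at hq
    have hlc := coeffPolynomial_leadingCoeff hv
    have hp0 : coeffPolynomial v ≠ 0 := fun h => by simp [h] at hlc
    have h1 := exp_le_integral_mul_norm_sq hpos hlog hp0 (integrable_mul_norm_sq_eval hf v)
    have h2 : 0 ≤ (coeffPolynomial v).logMahlerMeasure := by
      rw [Polynomial.logMahlerMeasure_eq_log_MahlerMeasure]
      refine Real.log_nonneg ?_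
      have := (coeffPolynomial v).leadingCoeff_le_mahlerMeasure
      simpa [hlc] using this
    rw [hq] at h1
    have h3 := (Real.le_log_iff_exp_le (by positivity)).2 h1
    rw [Real.log_div hd'.ne' hd.ne'] at h3
    push_cast
    linarith

theorem integral_fourier (m : ℤ) :
    ∫ x : UnitAddCircle, (fourier m x : ℂ) = if m = 0 then 1 else 0 := by
  split_ifs with h
  · simp [h, measureReal_def]
  · exact integral_eq_zero_of_add_right_eq_neg
      (fun x => fourier_add_half_inv_index h one_pos x)

theorem integral_fourier_mul_re_fourier (m k : ℤ) :
    ∫ x : UnitAddCircle, (fourier m x : ℂ) * ((fourier k x : ℂ).re : ℂ)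
      = ((if k = m then 1 else 0) + (if -k = m then 1 else 0)) / 2 := by
  have h : ∀ x : UnitAddCircle, (fourier m x : ℂ) * ((fourier k x : ℂ).re : ℂ)
      = (fourier (m + k) x + fourier (m + -k) x) / 2 := by
    intro x
    rw [Complex.re_eq_add_conj, ← fourier_neg, fourier_add, fourier_add]; ring
  have hI : ∀ j : ℤ, Integrable fun x : UnitAddCircle => (fourier j x : ℂ) := fun j =>
    (fourier j).continuous.integrable_of_hasCompactSupport (HasCompactSupport.of_compactSpace _)
  simp only [h]
  rw [MeasureTheory.integral_div, MeasureTheory.integral_add (hI _) (hI _), integral_fourier,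
    integral_fourier, add_comm]
  have e1 : (m + -k = 0) ↔ (k = m) := by omega
  have e2 : (m + k = 0) ↔ (-k = m) := by omega
  simp only [e1, e2]

theorem sum_fin_ite_sub_eq_nat (n d : ℕ) :
    ∑ i : Fin n, ∑ j : Fin n, (if (i : ℤ) - (j : ℤ) = d then (1 : ℝ) else 0) = ((n - d : ℕ) : ℝ) := by
  rw [Finset.sum_comm]
  have h : ∀ j : Fin n, ∑ i : Fin n, (if (i : ℤ) - (j : ℤ) = d then (1 : ℝ) else 0)
      = if (j : ℕ) < n - d then 1 else 0 := by
    intro j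
    split_ifs with hj
    · rw [Finset.sum_eq_single (⟨j + d, by omega⟩ : Fin n)]
      · simp
      · intro i _ hi
        refine if_neg fun h => hi (Fin.ext ?_)
        simp only; omega
      · simp
    · exact Finset.sum_eq_zero fun i _ => if_neg (by have := i.2; omega)
  simp only [h]
  rw [Fin.sum_univ_eq_sum_range (fun j => if j < n - d then (1 : ℝ) else 0) n, ← Finset.sum_filter]
  have : (Finset.range n).filter (fun j => j < n - d) = Finset.range (n - d) := by
    ext j; simp only [Finset.mem_filter, Finset.mem_range]; omega
  rw [this]; simp

theorem sum_fin_ite_sub_eq (n : ℕ) (m : ℤ) :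
    ∑ i : Fin n, ∑ j : Fin n, (if (i : ℤ) - (j : ℤ) = m then (1 : ℝ) else 0)
      = ((n - m.natAbs : ℕ) : ℝ) := by
  obtain ⟨d, rfl | rfl⟩ := m.eq_nat_or_neg
  · simpa using sum_fin_ite_sub_eq_nat n d
  · rw [Finset.sum_comm]
    have := sum_fin_ite_sub_eq_nat n d
    simp only [Int.natAbs_neg, Int.natAbs_natCast]
    rw [← this]
    refine Finset.sum_congr rfl fun i _ => Finset.sum_congr rfl fun j _ => ?_
    congr 1
    apply propext; omega

theorem tendsto_natCast_sub_div (d : ℕ) :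
    Tendsto (fun n : ℕ => ((n - d : ℕ) : ℝ) / n) atTop (𝓝 1) := by
  have h : Tendsto (fun n : ℕ => 1 - (d : ℝ) / n) atTop (𝓝 (1 - 0)) :=
    tendsto_const_nhds.sub (tendsto_const_div_atTop_nhds_zero_nat (d : ℝ))
  rw [sub_zero] at h
  refine h.congr' ?_
  filter_upwards [eventually_ge_atTop (d + 1)] with n hn
  have : (n : ℝ) ≠ 0 := by
    have : 0 < n := by omega
    positivity
  rw [Nat.cast_sub (by omega)]
  field_simp

theorem integrable_ofReal_mul_continuous {f : UnitAddCircle → ℝ} (hf : Integrable f)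
    (q : C(UnitAddCircle, ℂ)) : Integrable fun x => (f x : ℂ) * q x :=
  hf.ofReal.mul_bdd (c := ‖q‖) q.continuous.aestronglyMeasurable
    (Filter.Eventually.of_forall fun x => q.norm_coe_le_norm x)

theorem integral_mul_re_fourier_of_even {f : UnitAddCircle → ℝ} (hf : Integrable f)
    (heven : ∀ x, f (-x) = f x) (m : ℤ) :
    ((∫ x, f x * (fourier m x : ℂ).re : ℝ) : ℂ) = ∫ x, (f x : ℂ) * fourier m x := by
  have h1 : ∫ x, (f x : ℂ) * fourier m x = ∫ x, (f x : ℂ) * fourier (-m) x := by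
    rw [← integral_neg_eq_self (fun x => (f x : ℂ) * fourier m x) volume]
    congr 1; ext x
    rw [heven, fourier_apply, fourier_apply]
    simp
  have h2 : ∀ x, ((f x * (fourier m x : ℂ).re : ℝ) : ℂ)
      = ((f x : ℂ) * fourier m x + (f x : ℂ) * fourier (-m) x) / 2 := by
    intro x
    push_cast
    rw [Complex.re_eq_add_conj, ← fourier_neg]; ring
  rw [← integral_complex_ofReal]
  simp only [h2]
  rw [MeasureTheory.integral_div, MeasureTheory.integral_add
    (integrable_ofReal_mul_continuous hf _) (integrable_ofReal_mul_continuous hf _), ← h1]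
  ring

theorem tendsto_sum_cosCoeff_mul_cosCoeff_div {f : UnitAddCircle → ℝ} (hf : Integrable f)
    (heven : ∀ x, f (-x) = f x) {q : C(UnitAddCircle, ℂ)}
    (hq : q ∈ Submodule.span ℂ (Set.range (fourier (T := (1 : ℝ))))) :
    Tendsto (fun n : ℕ => (∑ i : Fin n, ∑ j : Fin n,
      ((∫ x, f x * (fourier ((i : ℤ) - (j : ℤ)) x : ℂ).re : ℝ) : ℂ)
        * ∫ x, q x * ((fourier ((i : ℤ) - (j : ℤ)) x : ℂ).re : ℂ)) / n) atTop
      (𝓝 (∫ x, (f x : ℂ) * q x)) := by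
  have hI : ∀ (q : C(UnitAddCircle, ℂ)) (k : ℤ),
      Integrable fun x => q x * ((fourier k x : ℂ).re : ℂ) := fun q k =>
    (q.continuous.mul (Complex.continuous_ofReal.comp (Complex.continuous_re.comp
      (fourier k).continuous))).integrable_of_hasCompactSupport (HasCompactSupport.of_compactSpace _)
  induction hq using Submodule.span_induction with
  | mem q hq =>
    obtain ⟨m, rfl⟩ := hq
    rw [← integral_mul_re_fourier_of_even hf heven]
    simp only [integral_fourier_mul_re_fourier]
    set c : ℝ := ∫ x, f x * (fourier m x : ℂ).re
    have hc : c = ∫ x, f x * (fourier (-m) x : ℂ).re := by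
      simp only [fourier_neg, Complex.conj_re, c]
    have hs : ∀ n : ℕ, (∑ i : Fin n, ∑ j : Fin n,
        ((∫ x, f x * (fourier ((i : ℤ) - (j : ℤ)) x : ℂ).re : ℝ) : ℂ)
          * (((if (i : ℤ) - (j : ℤ) = m then 1 else 0)
            + (if -((i : ℤ) - (j : ℤ)) = m then 1 else 0)) / 2)) / n
        = ((c * (((n - m.natAbs : ℕ) : ℝ) / n) : ℝ) : ℂ) := by
      intro n
      have h1 : ∀ k : ℤ, ((∫ x, f x * (fourier k x : ℂ).re : ℝ) : ℂ)
          * (((if k = m then 1 else 0) + (if -k = m then 1 else 0)) / 2)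
          = ((c / 2 * ((if k = m then 1 else 0) + (if k = -m then 1 else 0)) : ℝ) : ℂ) := by
        intro k
        have e : (-k = m) ↔ (k = -m) := by omega
        simp only [e]
        by_cases h1 : k = m
        · subst h1
          simp only [if_true]
          split_ifs <;> push_cast <;> ring
        · by_cases h2 : k = -m
          · subst h2
            rw [← hc]
            simp only [if_true, h1, if_false]
            push_cast; ring
          · simp [h1, h2]
      simp only [h1, ← Complex.ofReal_sum]
      rw [← Complex.ofReal_natCast, ← Complex.ofReal_div]
      congr 1
      simp only [← Finset.mul_sum, Finset.sum_add_distrib]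
      rw [sum_fin_ite_sub_eq, sum_fin_ite_sub_eq, Int.natAbs_neg]
      ring
    simp only [hs]
    have := (tendsto_natCast_sub_div m.natAbs).const_mul c
    rw [mul_one] at this
    exact (Complex.continuous_ofReal.tendsto c).comp this
  | zero => simp
  | add q r _ _ hq hr =>
    have h1 : ∫ x, (f x : ℂ) * (q + r) x = (∫ x, (f x : ℂ) * q x) + ∫ x, (f x : ℂ) * r x := by
      rw [← MeasureTheory.integral_add (integrable_ofReal_mul_continuous hf _)
        (integrable_ofReal_mul_continuous hf _)]
      simp only [ContinuousMap.add_apply, mul_add]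
    rw [h1]
    refine (hq.add hr).congr fun n => ?_
    rw [← add_div, ← Finset.sum_add_distrib]
    congr 1
    refine Finset.sum_congr rfl fun i _ => ?_
    rw [← Finset.sum_add_distrib]
    refine Finset.sum_congr rfl fun j _ => ?_
    rw [← mul_add, ← MeasureTheory.integral_add (hI q _) (hI r _)]
    simp only [ContinuousMap.add_apply, add_mul]
  | smul a q _ hq =>
    have h1 : ∫ x, (f x : ℂ) * (a • q) x = a * ∫ x, (f x : ℂ) * q x := by
      rw [← MeasureTheory.integral_const_mul]
      congr 1; ext x; simp only [ContinuousMap.smul_apply, smul_eq_mul]; ring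
    rw [h1]
    refine (hq.const_mul a).congr fun n => ?_
    rw [mul_div_assoc', Finset.mul_sum]
    congr 1
    refine Finset.sum_congr rfl fun i _ => ?_
    rw [Finset.mul_sum]
    refine Finset.sum_congr rfl fun j _ => ?_
    rw [mul_left_comm, ← MeasureTheory.integral_const_mul]
    congr 2; ext x; simp only [ContinuousMap.smul_apply, smul_eq_mul]; ring

/-- The upper Szegő bound obtained by testing against a positive trigonometric polynomial. -/
theorem eventually_log_det_circleToeplitz_div_le {f : UnitAddCircle → ℝ} (hf : Integrable f)
    (hpos : ∀ᵐ x, 0 < f x) (hlog : Integrable fun x => Real.log (f x))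
    (heven : ∀ x, f (-x) = f x) {q : C(UnitAddCircle, ℂ)}
    (hq : q ∈ Submodule.span ℂ (Set.range (fourier (T := (1 : ℝ)))))
    (hqpos : ∀ x, 0 < (q x).re) {ε : ℝ} (hε : 0 < ε) :
    ∀ᶠ n : ℕ in atTop, Real.log (circleToeplitz f n).det / n
      ≤ (∫ x, f x * (q x).re) - 1 - (∫ x, Real.log (q x).re) + ε := by
  have hre : Continuous fun x => (q x).re := Complex.continuous_re.comp q.continuous
  have hqi : Integrable fun x => (q x).re :=
    hre.integrable_of_hasCompactSupport (HasCompactSupport.of_compactSpace _)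
  have hqlog : Integrable fun x => Real.log (q x).re :=
    (hre.log fun x => (hqpos x).ne').integrable_of_hasCompactSupport
      (HasCompactSupport.of_compactSpace _)
  have hlim := (Complex.continuous_re.tendsto _).comp
    (tendsto_sum_cosCoeff_mul_cosCoeff_div hf heven hq)
  have hval : (∫ x, (f x : ℂ) * q x).re = ∫ x, f x * (q x).re := by
    have := integral_re (integrable_ofReal_mul_continuous hf q)
    simp only [RCLike.re_to_complex, Complex.re_ofReal_mul] at this
    exact this.symm
  rw [hval] at hlim
  have htr : ∀ n : ℕ, ((∑ i : Fin n, ∑ j : Fin n,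
      ((∫ x, f x * (fourier ((i : ℤ) - (j : ℤ)) x : ℂ).re : ℝ) : ℂ)
        * ∫ x, q x * ((fourier ((i : ℤ) - (j : ℤ)) x : ℂ).re : ℂ)) / n).re
      = (circleToeplitz f n * circleToeplitz (fun x => (q x).re) n).trace / n := by
    intro n
    rw [Complex.div_natCast_re, Complex.re_sum]
    congr 1
    rw [Matrix.trace]
    refine Finset.sum_congr rfl fun i _ => ?_
    rw [Complex.re_sum, Matrix.diag_apply, Matrix.mul_apply]
    refine Finset.sum_congr rfl fun j _ => ?_
    rw [Complex.re_ofReal_mul, ← (circleToeplitz_isHermitian _ n).apply j i, star_trivial]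
    simp only [circleToeplitz, Matrix.of_apply]
    congr 1
    have := integral_re ((q.continuous.mul (Complex.continuous_ofReal.comp
      (Complex.continuous_re.comp (fourier ((i : ℤ) - (j : ℤ))).continuous))
      ).integrable_of_hasCompactSupport (μ := volume) (HasCompactSupport.of_compactSpace _))
    simp only [RCLike.re_to_complex, Pi.mul_apply, Function.comp_apply, Complex.re_mul_ofReal] at this
    exact this.symm
  filter_upwards [hlim.eventually_le_const (lt_add_of_pos_right _ hε), eventually_gt_atTop 0]
    with n hn hn0
  simp only [Function.comp_apply, htr] at hn
  have hn0' : (0 : ℝ) < n := by exact_mod_cast hn0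
  have h1 := (circleToeplitz_posDef hf hpos hlog n).log_det_le_trace_mul_sub
    (circleToeplitz_posDef hqi (Filter.Eventually.of_forall hqpos) hqlog n)
  have h2 := nat_mul_integral_log_le_log_det_circleToeplitz hqi
    (Filter.Eventually.of_forall hqpos) hqlog n
  rw [Fintype.card_fin] at h1
  rw [div_le_iff₀ hn0'] at hn ⊢
  linarith

theorem exists_mem_span_fourier_integral_abs_sub_le {f g : UnitAddCircle → ℝ}
    (hf : Integrable f) (hpos : ∀ᵐ x, 0 < f x) (hg : AEStronglyMeasurable g) {δ M η : ℝ}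
    (hδ : 0 < δ) (hη : 0 < η) (hgδ : ∀ᵐ x, δ ≤ g x) (hgM : ∀ᵐ x, g x ≤ M) :
    ∃ q ∈ Submodule.span ℂ (Set.range (fourier (T := (1 : ℝ)))), (∀ x, δ / 2 ≤ (q x).re) ∧
      ∫ x, (1 + f x) * |g x - (q x).re| ≤ η := by
  have hW : Integrable fun x => 1 + f x := (integrable_const _).add hf
  set W := ∫ x, (1 + f x) with hWdef
  have hW1 : 1 ≤ W := by
    have h0 : 0 ≤ ∫ x, f x := integral_nonneg_of_ae (hpos.mono fun x hx => hx.le)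
    have : W = 1 + ∫ x, f x := by
      rw [hWdef, MeasureTheory.integral_add (integrable_const _) hf]; simp [measureReal_def]
    linarith
  set μ : Measure UnitAddCircle := volume.withDensity fun x => ENNReal.ofReal (1 + f x) with hμ
  have hconv : ∀ F : UnitAddCircle → ℝ, ∫ x, F x ∂μ = ∫ x, (1 + f x) * F x := by
    intro F
    rw [hμ, integral_withDensity_eq_integral_toReal_smul₀ hW.1.aemeasurable.ennreal_ofReal
      (Filter.Eventually.of_forall fun _ => ENNReal.ofReal_lt_top)]
    refine integral_congr_ae (hpos.mono fun x hx => ?_)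
    simp only [smul_eq_mul]
    rw [ENNReal.toReal_ofReal (by linarith)]
  have hac : μ ≪ volume := withDensity_absolutelyContinuous _ _
  have : IsFiniteMeasure μ := isFiniteMeasure_withDensity_ofReal hW.2
  have hgb : ∀ᵐ x ∂μ, ‖g x‖ ≤ M := by
    filter_upwards [hac.ae_le hgδ, hac.ae_le hgM] with x h1 h2
    rw [Real.norm_eq_abs, abs_of_nonneg (hδ.le.trans h1)]; exact h2
  have hgi : Integrable g μ := Integrable.of_bound (hg.mono_ac hac) M hgb
  obtain ⟨h, hh, hhi⟩ := hgi.exists_boundedContinuous_integral_sub_le (half_pos hη)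
  let h' : C(UnitAddCircle, ℂ) :=
    ⟨fun x => ((max (h x) δ : ℝ) : ℂ),
      Complex.continuous_ofReal.comp (h.continuous.max continuous_const)⟩
  set η' := min (δ / 2) (η / (2 * W))
  have hη' : 0 < η' := lt_min (by positivity) (by positivity)
  have hmem : h' ∈ closure (Submodule.span ℂ (Set.range (fourier (T := (1 : ℝ)))) :
      Set C(UnitAddCircle, ℂ)) := by
    rw [← Submodule.topologicalClosure_coe, span_fourier_closure_eq_top]; trivial
  obtain ⟨q, hq, hdist⟩ := Metric.mem_closure_iff.1 hmem η' hη'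
  have hnear : ∀ x, |max (h x) δ - (q x).re| ≤ η' := by
    intro x
    have h1 : ‖(h' - q) x‖ ≤ ‖h' - q‖ := (h' - q).norm_coe_le_norm x
    rw [← dist_eq_norm] at h1
    have h2 := Complex.abs_re_le_norm ((h' - q) x)
    simp only [ContinuousMap.sub_apply, Complex.sub_re] at h1 h2
    exact (h2.trans h1).trans hdist.le
  refine ⟨q, hq, fun x => ?_, ?_⟩
  · have h1 := (abs_le.1 (hnear x)).2
    have h2 : η' ≤ δ / 2 := min_le_left _ _
    have h3 : δ ≤ max (h x) δ := le_max_right _ _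
    linarith
  · rw [← hconv]
    have hle : ∫ x, |g x - (q x).re| ∂μ ≤ ∫ x, (‖g x - h x‖ + η') ∂μ := by
      refine integral_mono_of_nonneg (Filter.Eventually.of_forall fun _ => abs_nonneg _)
        ((hgi.sub hhi).norm.add (integrable_const _)) ?_
      filter_upwards [hac.ae_le hgδ] with x hx
      have h1 : |g x - max (h x) δ| ≤ |g x - h x| := by
        rcases le_total (h x) δ with hc | hc
        · rw [max_eq_right hc, abs_of_nonneg (by linarith), abs_of_nonneg (by linarith)]; linarith
        · rw [max_eq_left hc]
      have h2 := abs_sub_le (g x) (max (h x) δ) (q x).re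
      rw [Real.norm_eq_abs]
      linarith [hnear x]
    have hc : ∫ _, η' ∂μ = W * η' := by
      rw [hconv, MeasureTheory.integral_mul_const]
    have hadd : ∫ x, (‖g x - h x‖ + η') ∂μ = (∫ x, ‖g x - h x‖ ∂μ) + W * η' := by
      rw [MeasureTheory.integral_add (f := fun x => ‖g x - h x‖) (hgi.sub hhi).norm
        (integrable_const _), hc]
    have hWη : W * η' ≤ η / 2 := by
      calc W * η' ≤ W * (η / (2 * W)) := by gcongr; exact min_le_right _ _
        _ = η / 2 := by field_simp
    linarith

theorem exists_bounded_integral_mul_sub_log_le {f : UnitAddCircle → ℝ} (hf : Integrable f)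
    (hpos : ∀ᵐ x, 0 < f x) (hlog : Integrable fun x => Real.log (f x)) {ε : ℝ} (hε : 0 < ε) :
    ∃ δ > 0, (∫ x, f x * (1 / (f x + δ) + δ)) - 1 - (∫ x, Real.log (1 / (f x + δ) + δ))
      ≤ (∫ x, Real.log (f x)) + ε := by
  have hbd : ∀ δ : ℝ, 0 < δ → δ ≤ 1 → ∀ y : ℝ, 0 < y →
      |y * (1 / (y + δ) + δ) - 1| ≤ 1 + y ∧
      |Real.log (y * (1 / (y + δ) + δ))| ≤ |Real.log y| + y := by
    intro δ hδ hδ1 y hy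
    have e : y * (1 / (y + δ) + δ) = y / (y + δ) + δ * y := by ring
    have h1 : 0 < y / (y + δ) := by positivity
    have h2 : y / (y + δ) ≤ 1 := (div_le_one (by positivity)).2 (by linarith)
    have h3 : 0 < δ * y := by positivity
    have h4 : δ * y ≤ y := by nlinarith
    rw [e]
    refine ⟨abs_le.2 ⟨by linarith, by linarith⟩, abs_le.2 ⟨?_, ?_⟩⟩
    · have h5 : Real.log (y / (y + 1)) ≤ Real.log (y / (y + δ) + δ * y) := by
        refine Real.log_le_log (by positivity) ?_
        have : y / (y + 1) ≤ y / (y + δ) := by gcongr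
        linarith
      rw [Real.log_div hy.ne' (by positivity)] at h5
      have h6 := Real.log_le_sub_one_of_pos (show 0 < y + 1 by linarith)
      have h7 := neg_abs_le (Real.log y)
      linarith
    · have h6 := Real.log_le_sub_one_of_pos (show 0 < y / (y + δ) + δ * y by positivity)
      have h7 := abs_nonneg (Real.log y)
      linarith
  let d : ℕ → ℝ := fun m => 1 / ((m : ℝ) + 1)
  have hd0 : ∀ m, 0 < d m := fun m => by positivity
  have hd1 : ∀ m, d m ≤ 1 := fun m => by
    rw [div_le_one (by positivity)]; linarith [(Nat.cast_nonneg m : (0 : ℝ) ≤ m)]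
  have hdlim : Tendsto d atTop (𝓝 0) := tendsto_one_div_add_atTop_nhds_zero_nat
  have hgm : ∀ m, AEMeasurable fun x => 1 / (f x + d m) + d m := fun m =>
    ((hf.1.aemeasurable.add_const _).const_div 1).add_const _
  have hA : ∀ m, Integrable fun x => f x * (1 / (f x + d m) + d m) - 1 := fun m =>
    ((integrable_const 1).add hf).mono'
      (((hf.1.aemeasurable.mul (hgm m)).sub_const 1).aestronglyMeasurable)
      (hpos.mono fun x hx => (hbd _ (hd0 m) (hd1 m) _ hx).1)
  have hB : ∀ m, Integrable fun x => Real.log (f x * (1 / (f x + d m) + d m)) := fun m =>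
    (hlog.abs.add hf).mono'
      ((Real.measurable_log.comp_aemeasurable (hf.1.aemeasurable.mul (hgm m))).aestronglyMeasurable)
      (hpos.mono fun x hx => (hbd _ (hd0 m) (hd1 m) _ hx).2)
  have hlim : Tendsto (fun m => ∫ x, ((f x * (1 / (f x + d m) + d m) - 1)
      - Real.log (f x * (1 / (f x + d m) + d m)))) atTop (𝓝 (∫ _ : UnitAddCircle, (0 : ℝ))) := by
    refine tendsto_integral_of_dominated_convergence
      (fun x => (1 + f x) + (|Real.log (f x)| + f x))
      (fun m => ((hA m).sub (hB m)).1)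
      (((integrable_const 1).add hf).add (hlog.abs.add hf)) ?_ ?_
    · intro m
      filter_upwards [hpos] with x hx
      have h := hbd _ (hd0 m) (hd1 m) _ hx
      exact (abs_sub _ _).trans (add_le_add h.1 h.2)
    · filter_upwards [hpos] with x hx
      have h1 : Tendsto (fun m => f x * (1 / (f x + d m) + d m)) atTop
          (𝓝 (f x * (1 / (f x + 0) + 0))) :=
        (((tendsto_const_nhds.div (hdlim.const_add (f x)) (by simpa using hx.ne')).add
          hdlim).const_mul _)
      have e : f x * (1 / (f x + 0) + 0) = 1 := by
        have := hx.ne'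
        field_simp; ring
      rw [e] at h1
      have h2 := (h1.sub_const 1).sub (h1.log one_ne_zero)
      simpa using h2
  rw [MeasureTheory.integral_zero] at hlim
  obtain ⟨m, hm⟩ := (hlim.eventually_le_const hε).exists
  refine ⟨d m, hd0 m, ?_⟩
  have hsplit : ∀ᵐ x, Real.log (f x * (1 / (f x + d m) + d m))
      = Real.log (f x) + Real.log (1 / (f x + d m) + d m) := by
    filter_upwards [hpos] with x hx
    have := hd0 m
    exact Real.log_mul hx.ne' (by positivity)
  have hLg : Integrable fun x => Real.log (1 / (f x + d m) + d m) := by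
    refine ((hB m).sub hlog).congr ?_
    filter_upwards [hsplit] with x hx
    simp only [Pi.sub_apply, hx]; ring
  have hfg : Integrable fun x => f x * (1 / (f x + d m) + d m) := by
    refine ((hA m).add (integrable_const 1)).congr (Filter.Eventually.of_forall fun x => ?_)
    simp
  rw [MeasureTheory.integral_sub (hA m) (hB m), integral_congr_ae hsplit,
    MeasureTheory.integral_add hlog hLg, MeasureTheory.integral_sub hfg (integrable_const 1)] at hm
  have h1 : ∫ _ : UnitAddCircle, (1 : ℝ) = 1 := by simp [measureReal_def]
  rw [h1] at hm
  linarith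

theorem exists_mem_span_fourier_integral_mul_sub_log_le {f : UnitAddCircle → ℝ} (hf : Integrable f)
    (hpos : ∀ᵐ x, 0 < f x) (hlog : Integrable fun x => Real.log (f x)) {ε : ℝ} (hε : 0 < ε) :
    ∃ q ∈ Submodule.span ℂ (Set.range (fourier (T := (1 : ℝ)))), (∀ x, 0 < (q x).re) ∧
      (∫ x, f x * (q x).re) - 1 - (∫ x, Real.log (q x).re) ≤ (∫ x, Real.log (f x)) + ε := by
  obtain ⟨δ, hδ, hle⟩ := exists_bounded_integral_mul_sub_log_le hf hpos hlog (half_pos hε)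
  set g : UnitAddCircle → ℝ := fun x => 1 / (f x + δ) + δ with hg
  have hgm : AEStronglyMeasurable g :=
    (((hf.1.aemeasurable.add_const _).const_div 1).add_const _).aestronglyMeasurable
  have hgδ : ∀ᵐ x, δ ≤ g x := hpos.mono fun x hx => by
    have : 0 ≤ 1 / (f x + δ) := by positivity
    simp only [hg]; linarith
  have hgM : ∀ᵐ x, g x ≤ 1 / δ + δ := hpos.mono fun x hx => by
    have : 1 / (f x + δ) ≤ 1 / δ := by gcongr; linarith
    simp only [hg]; linarith
  set K := 1 + 2 / δ
  have hK : 0 < K := by positivity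
  obtain ⟨q, hq, hqδ, hqint⟩ := exists_mem_span_fourier_integral_abs_sub_le hf hpos hgm hδ
    (show 0 < ε / 2 / K by positivity) hgδ hgM
  have hq0 : ∀ x, 0 < (q x).re := fun x => (half_pos hδ).trans_le (hqδ x)
  refine ⟨q, hq, hq0, ?_⟩
  have hre : Continuous fun x => (q x).re := Complex.continuous_re.comp q.continuous
  have hqlog : Integrable fun x => Real.log (q x).re :=
    (hre.log fun x => (hq0 x).ne').integrable_of_hasCompactSupport
      (HasCompactSupport.of_compactSpace _)
  have hfq : Integrable fun x => f x * (q x).re :=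
    hf.mul_bdd (c := ‖q‖) hre.aestronglyMeasurable (Filter.Eventually.of_forall fun x =>
      (Complex.abs_re_le_norm _).trans (q.norm_coe_le_norm x))
  have hgabs : ∀ᵐ x, |g x| ≤ 1 / δ + δ := by
    filter_upwards [hgδ, hgM] with x h1 h2
    rw [abs_of_nonneg (hδ.le.trans h1)]; exact h2
  have hgi : Integrable g := Integrable.of_bound hgm _ hgabs
  have hfg : Integrable fun x => f x * g x := hf.mul_bdd hgm hgabs
  have hglog : Integrable fun x => Real.log (g x) := by
    refine Integrable.of_bound (C := |Real.log δ| + |Real.log (1 / δ + δ)|)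
      (Real.measurable_log.comp_aemeasurable hgm.aemeasurable).aestronglyMeasurable ?_
    filter_upwards [hgδ, hgM] with x h1 h2
    have h3 := Real.log_le_log hδ h1
    have h4 := Real.log_le_log (hδ.trans_le h1) h2
    rw [Real.norm_eq_abs, abs_le]
    constructor
    · linarith [neg_abs_le (Real.log δ), abs_nonneg (Real.log (1 / δ + δ))]
    · linarith [le_abs_self (Real.log (1 / δ + δ)), abs_nonneg (Real.log δ)]
  have hqi : Integrable fun x => (q x).re :=
    hre.integrable_of_hasCompactSupport (HasCompactSupport.of_compactSpace _)
  have habs : Integrable fun x => (1 + f x) * |g x - (q x).re| := by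
    refine ((integrable_const 1).add hf).mul_bdd (c := 1 / δ + δ + ‖q‖)
      (hgi.sub hqi).abs.1 ?_
    filter_upwards [hgabs] with x hx
    rw [Real.norm_eq_abs, abs_abs]
    refine (abs_sub _ _).trans (add_le_add hx ?_)
    exact (Complex.abs_re_le_norm _).trans (q.norm_coe_le_norm x)
  have hmain : ∫ x, (f x * (q x).re - Real.log (q x).re)
      ≤ ∫ x, ((f x * g x - Real.log (g x)) + K * ((1 + f x) * |g x - (q x).re|)) := by
    refine integral_mono_ae (hfq.sub hqlog) ((hfg.sub hglog).add (habs.const_mul K)) ?_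
    filter_upwards [hpos, hgδ] with x hx hgx
    have hgp : 0 < g x := hδ.trans_le hgx
    set r := (q x).re
    have hr : δ / 2 ≤ r := hqδ x
    have hr0 : 0 < r := hq0 x
    set A := |g x - r|
    have hA : 0 ≤ A := abs_nonneg _
    have h1 : Real.log (g x) - Real.log r ≤ A * (2 / δ) := by
      rw [← Real.log_div hgp.ne' hr0.ne']
      refine (Real.log_le_sub_one_of_pos (by positivity)).trans ?_
      have e : g x / r - 1 = (g x - r) / r := by field_simp
      rw [e]
      calc (g x - r) / r ≤ A / r := by gcongr; exact le_abs_self _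
        _ ≤ A / (δ / 2) := by gcongr
        _ = A * (2 / δ) := by field_simp
    have h2 : f x * (r - g x) ≤ f x * A := by
      gcongr
      exact (le_abs_self _).trans_eq (abs_sub_comm _ _)
    have h3 : 0 ≤ 2 / δ := by positivity
    have h4 : K * ((1 + f x) * A) = A + f x * A + A * (2 / δ) + 2 / δ * (f x * A) := by
      simp only [K]; ring
    have h5 : 0 ≤ 2 / δ * (f x * A) := by positivity
    rw [h4]
    nlinarith
  rw [MeasureTheory.integral_sub hfq hqlog, MeasureTheory.integral_add
    (f := fun x => f x * g x - Real.log (g x)) (hfg.sub hglog)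
    (habs.const_mul K), MeasureTheory.integral_sub hfg hglog,
    MeasureTheory.integral_const_mul] at hmain
  have hfin : K * ∫ x, (1 + f x) * |g x - (q x).re| ≤ ε / 2 := by
    calc K * ∫ x, (1 + f x) * |g x - (q x).re| ≤ K * (ε / 2 / K) := by gcongr
      _ = ε / 2 := by field_simp
  linarith

/-- **Szegő's first limit theorem** for even, a.e. positive, integrable symbols with integrable
logarithm. -/
theorem tendsto_log_det_circleToeplitz_div {f : UnitAddCircle → ℝ} (hf : Integrable f)
    (hpos : ∀ᵐ x, 0 < f x) (hlog : Integrable fun x => Real.log (f x))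
    (heven : ∀ x, f (-x) = f x) :
    Tendsto (fun n : ℕ => Real.log (circleToeplitz f n).det / n) atTop
      (𝓝 (∫ x, Real.log (f x))) := by
  rw [tendsto_order]
  constructor
  · intro a ha
    filter_upwards [eventually_gt_atTop 0] with n hn
    have hn' : (0 : ℝ) < n := by exact_mod_cast hn
    have := nat_mul_integral_log_le_log_det_circleToeplitz hf hpos hlog n
    rw [lt_div_iff₀ hn']
    nlinarith
  · intro a ha
    set ε := (a - ∫ x, Real.log (f x)) / 3
    have hε : 0 < ε := by simp only [ε]; linarith
    obtain ⟨q, hq, hqpos, hle⟩ := exists_mem_span_fourier_integral_mul_sub_log_le hf hpos hlog hε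
    filter_upwards [eventually_log_det_circleToeplitz_div_le hf hpos hlog heven hq hqpos hε]
      with n hn
    have : a = (∫ x, Real.log (f x)) + 3 * ε := by simp only [ε]; ring
    linarith

end Szego

section SpectralRepresentation

open MeasureTheory

theorem lintegral_ofReal_eq_of_integral_eq {α : Type*} [MeasurableSpace α] {μ : Measure α}
    {g : α → ℝ} {c : ℝ} (hg : 0 ≤ᵐ[μ] g) (hc : c ≠ 0) (h : ∫ x, g x ∂μ = c) :
    ∫⁻ x, ENNReal.ofReal (g x) ∂μ = ENNReal.ofReal c := by
  rw [← h, ofReal_integral_eq_lintegral_ofReal (Integrable.of_integral_ne_zero (h ▸ hc)) hg]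

theorem integral_one_sub_cos_mul_exp_neg {t : ℝ} (ht : 0 < t) :
    ∫ x in Set.Ioi (0 : ℝ), (1 - Real.cos x) * Real.exp (-t * x) = 1 / (t * (1 + t ^ 2)) := by
  have hre1 : (-(t : ℂ)).re < 0 := by simpa using ht
  have hre2 : (-(t : ℂ) + Complex.I).re < 0 := by simpa using ht
  have i1 := integrableOn_exp_mul_complex_Ioi hre1 0
  have i2 := integrableOn_exp_mul_complex_Ioi hre2 0
  have h1 := integral_exp_mul_complex_Ioi hre1 0
  have h2 := integral_exp_mul_complex_Ioi hre2 0
  have h3 := integral_re (i1.sub i2)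
  rw [integral_sub' i1 i2, h1, h2] at h3
  have e : ∀ x : ℝ, ((fun x : ℝ => Complex.exp (-(t : ℂ) * x)) - fun x : ℝ =>
      Complex.exp ((-(t : ℂ) + Complex.I) * x)) x
      = ((Real.exp (-t * x) : ℝ) : ℂ) - Complex.exp ((-t * x : ℝ) + (x : ℝ) * Complex.I) := by
    intro x
    simp only [Pi.sub_apply]
    push_cast
    congr 2; ring
  have e2 : ∀ x : ℝ, RCLike.re (((fun x : ℝ => Complex.exp (-(t : ℂ) * x)) - fun x : ℝ =>
      Complex.exp ((-(t : ℂ) + Complex.I) * x)) x) = (1 - Real.cos x) * Real.exp (-t * x) := by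
    intro x
    rw [e, RCLike.re_to_complex, Complex.sub_re, Complex.ofReal_re, Complex.exp_re]
    simp
    ring
  simp only [e2] at h3
  rw [h3]
  have ht' : (t : ℂ) ≠ 0 := by exact_mod_cast ht.ne'
  have hz : (-(t : ℂ) + Complex.I) ≠ 0 := fun h => by rw [h] at hre2; simp at hre2
  have hz2 : (1 + (t : ℂ) ^ 2) ≠ 0 := by
    have : (1 + t ^ 2 : ℝ) ≠ 0 := by positivity
    exact_mod_cast this
  have e3 : -Complex.exp (-(t : ℂ) * (0 : ℝ)) / -(t : ℂ)
      - -Complex.exp ((-(t : ℂ) + Complex.I) * (0 : ℝ)) / (-(t : ℂ) + Complex.I)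
      = ((1 / (t * (1 + t ^ 2)) : ℝ) : ℂ) - ((1 / (1 + t ^ 2) : ℝ) : ℂ) * Complex.I := by
    push_cast
    simp only [mul_zero, Complex.exp_zero]
    field_simp
    linear_combination ((t : ℂ)) * Complex.I_sq
  rw [e3, RCLike.re_to_complex, Complex.sub_re, Complex.ofReal_re, Complex.re_ofReal_mul, Complex.I_re]
  ring

theorem lintegral_one_sub_cos_mul_rpow {a : ℝ} (h0 : 0 < a) (h2 : a < 2) :
    ∫⁻ x in Set.Ioi (0 : ℝ), ENNReal.ofReal ((1 - Real.cos x) * x ^ (-a - 1))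
      = ENNReal.ofReal (π / (2 * Real.Gamma (a + 1) * Real.sin (π * (a / 2)))) := by
  have hG : 0 < Real.Gamma (a + 1) := Real.Gamma_pos_of_pos (by linarith)
  have hG1 : 0 < Real.Gamma (a / 2) := Real.Gamma_pos_of_pos (by linarith)
  have hG2 : 0 < Real.Gamma (1 - a / 2) := Real.Gamma_pos_of_pos (by linarith)
  have hcos : ∀ x : ℝ, 0 ≤ 1 - Real.cos x := fun x => by linarith [Real.cos_le_one x]
  have h_gamma : ∀ x ∈ Set.Ioi (0 : ℝ),
      ENNReal.ofReal (Real.Gamma (a + 1)) * ENNReal.ofReal ((1 - Real.cos x) * x ^ (-a - 1))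
      = ∫⁻ t in Set.Ioi (0 : ℝ), ENNReal.ofReal ((1 - Real.cos x) * (t ^ a * Real.exp (-(x * t)))) := by
    intro x hx
    have hx' : 0 < x := hx
    have h := Real.integral_rpow_mul_exp_neg_mul_Ioi (a := a + 1) (by linarith) hx'
    rw [add_sub_cancel_right] at h
    have hl := lintegral_ofReal_eq_of_integral_eq (μ := volume.restrict (Set.Ioi (0 : ℝ)))
      (g := fun t => t ^ a * Real.exp (-(x * t)))
      ((ae_restrict_iff' measurableSet_Ioi).2 (Filter.Eventually.of_forall fun t ht => by
        have : (0 : ℝ) < t := ht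
        simp only [Pi.zero_apply]; positivity)) (by positivity) h
    simp only [ENNReal.ofReal_mul (hcos x)]
    rw [lintegral_const_mul' _ _ ENNReal.ofReal_ne_top, hl, mul_left_comm]
    congr 1
    rw [← ENNReal.ofReal_mul hG.le, mul_comm, one_div, Real.inv_rpow hx'.le, ← Real.rpow_neg hx'.le]
    congr 3; ring
  have h_swap : ∀ t ∈ Set.Ioi (0 : ℝ),
      ∫⁻ x in Set.Ioi (0 : ℝ), ENNReal.ofReal ((1 - Real.cos x) * (t ^ a * Real.exp (-(x * t))))
      = ∫⁻ r in Set.Ioi (0 : ℝ), ENNReal.ofReal (t ^ (a - 1) * Real.exp (-((1 + t ^ 2) * r))) := by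
    intro t ht
    have ht' : 0 < t := ht
    have ht2 : 0 < 1 + t ^ 2 := by positivity
    have hl := lintegral_ofReal_eq_of_integral_eq (μ := volume.restrict (Set.Ioi (0 : ℝ)))
      (g := fun x => (1 - Real.cos x) * Real.exp (-t * x))
      (Filter.Eventually.of_forall fun x => mul_nonneg (hcos x) (Real.exp_pos _).le)
      (by positivity) (integral_one_sub_cos_mul_exp_neg ht')
    have hr : ∫ r in Set.Ioi (0 : ℝ), Real.exp (-((1 + t ^ 2) * r)) = 1 / (1 + t ^ 2) := by
      have := integral_exp_mul_Ioi (a := -(1 + t ^ 2)) (by linarith) 0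
      simp only [neg_mul, mul_zero, Real.exp_zero] at this
      rw [this, neg_div_neg_eq]
    have hl2 := lintegral_ofReal_eq_of_integral_eq (μ := volume.restrict (Set.Ioi (0 : ℝ)))
      (g := fun r => Real.exp (-((1 + t ^ 2) * r)))
      (Filter.Eventually.of_forall fun x => (Real.exp_pos _).le) (by positivity) hr
    have e : ∀ x : ℝ, (1 - Real.cos x) * (t ^ a * Real.exp (-(x * t)))
        = t ^ a * ((1 - Real.cos x) * Real.exp (-t * x)) := by
      intro x; rw [show -(x * t) = -t * x by ring]; ring
    simp only [e]
    simp only [ENNReal.ofReal_mul (Real.rpow_nonneg ht'.le _)]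
    rw [lintegral_const_mul' _ _ ENNReal.ofReal_ne_top, lintegral_const_mul' _ _ ENNReal.ofReal_ne_top,
      hl, hl2, ← ENNReal.ofReal_mul (by positivity), ← ENNReal.ofReal_mul (by positivity)]
    congr 1
    rw [Real.rpow_sub_one ht'.ne']
    field_simp
  have h_gauss : ∀ r ∈ Set.Ioi (0 : ℝ),
      ∫⁻ t in Set.Ioi (0 : ℝ), ENNReal.ofReal (t ^ (a - 1) * Real.exp (-((1 + t ^ 2) * r)))
      = ENNReal.ofReal (Real.Gamma (a / 2) / 2 * (Real.exp (-r) * r ^ ((1 - a / 2) - 1))) := by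
    intro r hr
    have hr' : 0 < r := hr
    have h := integral_rpow_mul_exp_neg_mul_rpow (p := 2) (q := a - 1) (b := r) (by norm_num)
      (by linarith) hr'
    have hl := lintegral_ofReal_eq_of_integral_eq (μ := volume.restrict (Set.Ioi (0 : ℝ)))
      (g := fun t => t ^ (a - 1) * Real.exp (-r * t ^ (2 : ℝ)))
      ((ae_restrict_iff' measurableSet_Ioi).2 (Filter.Eventually.of_forall fun t ht => by
        have : (0 : ℝ) < t := ht
        simp only [Pi.zero_apply]; positivity))
      (by rw [sub_add_cancel]; positivity) h
    have e : ∀ t : ℝ, t ^ (a - 1) * Real.exp (-((1 + t ^ 2) * r))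
        = Real.exp (-r) * (t ^ (a - 1) * Real.exp (-r * t ^ (2 : ℝ))) := by
      intro t
      rw [show -((1 + t ^ 2) * r) = -r + -r * t ^ 2 by ring, Real.exp_add, Real.rpow_two]; ring
    simp only [e]
    simp only [ENNReal.ofReal_mul (Real.exp_pos (-r)).le]
    rw [lintegral_const_mul' _ _ ENNReal.ofReal_ne_top, hl, ← ENNReal.ofReal_mul (Real.exp_pos _).le]
    congr 1
    rw [sub_add_cancel, show (1 - a / 2) - 1 = -(a / 2) by ring, show -a / 2 = -(a / 2) by ring]
    ring
  have h_total : ∫⁻ r in Set.Ioi (0 : ℝ),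
      ENNReal.ofReal (Real.Gamma (a / 2) / 2 * (Real.exp (-r) * r ^ ((1 - a / 2) - 1)))
      = ENNReal.ofReal (Real.Gamma (a / 2) / 2 * Real.Gamma (1 - a / 2)) := by
    simp only [ENNReal.ofReal_mul (show 0 ≤ Real.Gamma (a / 2) / 2 by positivity)]
    rw [lintegral_const_mul' _ _ ENNReal.ofReal_ne_top]
    congr 1
    exact lintegral_ofReal_eq_of_integral_eq
      ((ae_restrict_iff' measurableSet_Ioi).2 (Filter.Eventually.of_forall fun t ht => by
        have : (0 : ℝ) < t := ht
        simp only [Pi.zero_apply]; positivity)) hG2.ne'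
      (Real.Gamma_eq_integral (by linarith)).symm
  have hΓ : Real.Gamma (a / 2) / 2 * Real.Gamma (1 - a / 2)
      = Real.Gamma (a + 1) * (π / (2 * Real.Gamma (a + 1) * Real.sin (π * (a / 2)))) := by
    rw [div_mul_eq_mul_div, Real.Gamma_mul_Gamma_one_sub]
    field_simp
  have key : ENNReal.ofReal (Real.Gamma (a + 1))
      * ∫⁻ x in Set.Ioi (0 : ℝ), ENNReal.ofReal ((1 - Real.cos x) * x ^ (-a - 1))
      = ENNReal.ofReal (Real.Gamma (a + 1))
        * ENNReal.ofReal (π / (2 * Real.Gamma (a + 1) * Real.sin (π * (a / 2)))) := by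
    rw [← lintegral_const_mul' _ _ ENNReal.ofReal_ne_top, setLIntegral_congr_fun measurableSet_Ioi h_gamma,
      lintegral_lintegral_swap, setLIntegral_congr_fun measurableSet_Ioi h_swap,
      lintegral_lintegral_swap, setLIntegral_congr_fun measurableSet_Ioi h_gauss, h_total, hΓ,
      ENNReal.ofReal_mul hG.le]
    · refine Measurable.aemeasurable ?_
      fun_prop
    · refine Measurable.aemeasurable ?_
      fun_prop
  have hne : ENNReal.ofReal (Real.Gamma (a + 1)) ≠ 0 := by simpa using hG
  exact (ENNReal.mul_right_inj hne ENNReal.ofReal_ne_top).1 key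

theorem sin_pi_mul_half_pos {a : ℝ} (h0 : 0 < a) (h2 : a < 2) : 0 < Real.sin (π * (a / 2)) :=
  Real.sin_pos_of_pos_of_lt_pi (by positivity) (by nlinarith [Real.pi_pos])

theorem integrableOn_one_sub_cos_mul_rpow {a : ℝ} (h0 : 0 < a) (h2 : a < 2) :
    IntegrableOn (fun x : ℝ => (1 - Real.cos x) * x ^ (-a - 1)) (Set.Ioi 0) := by
  refine ⟨Measurable.aestronglyMeasurable (by fun_prop), ?_⟩
  rw [hasFiniteIntegral_iff_ofReal, lintegral_one_sub_cos_mul_rpow h0 h2]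
  · exact ENNReal.ofReal_lt_top
  · refine (ae_restrict_iff' measurableSet_Ioi).2 (Filter.Eventually.of_forall fun x hx => ?_)
    exact mul_nonneg (by linarith [Real.cos_le_one x]) (Real.rpow_nonneg (le_of_lt hx) _)

theorem integral_one_sub_cos_mul_rpow {a : ℝ} (h0 : 0 < a) (h2 : a < 2) :
    ∫ x in Set.Ioi (0 : ℝ), (1 - Real.cos x) * x ^ (-a - 1)
      = π / (2 * Real.Gamma (a + 1) * Real.sin (π * (a / 2))) := by
  have hG : 0 < Real.Gamma (a + 1) := Real.Gamma_pos_of_pos (by linarith)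
  have hs := sin_pi_mul_half_pos h0 h2
  rw [integral_eq_lintegral_of_nonneg_ae, lintegral_one_sub_cos_mul_rpow h0 h2,
    ENNReal.toReal_ofReal (by positivity)]
  · refine (ae_restrict_iff' measurableSet_Ioi).2 (Filter.Eventually.of_forall fun x hx => ?_)
    exact mul_nonneg (by linarith [Real.cos_le_one x]) (Real.rpow_nonneg (le_of_lt hx) _)
  · exact Measurable.aestronglyMeasurable (by fun_prop)

theorem one_sub_cos_mul_rpow_scale (a : ℝ) {b x : ℝ} (hb : b ≠ 0) (hx : 0 < x) :
    (1 - Real.cos (b * x)) * x ^ (-a - 1)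
      = |b| ^ (a + 1) * ((1 - Real.cos (|b| * x)) * (|b| * x) ^ (-a - 1)) := by
  have hb' : 0 < |b| := abs_pos.2 hb
  have hc : Real.cos (|b| * x) = Real.cos (b * x) := by
    rw [← Real.cos_abs (b * x), abs_mul, abs_of_pos hx]
  have h1 : |b| ^ (a + 1) * |b| ^ (-a - 1) = 1 := by
    rw [← Real.rpow_add hb']; ring_nf; simp
  rw [hc, Real.mul_rpow hb'.le hx.le]
  linear_combination -(1 - Real.cos (b * x)) * x ^ (-a - 1) * h1

theorem integrableOn_one_sub_cos_mul_mul_rpow {a : ℝ} (h0 : 0 < a) (h2 : a < 2) (b : ℝ) :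
    IntegrableOn (fun x : ℝ => (1 - Real.cos (b * x)) * x ^ (-a - 1)) (Set.Ioi 0) := by
  rcases eq_or_ne b 0 with rfl | hb
  · simp
  · have hb' : 0 < |b| := abs_pos.2 hb
    refine (IntegrableOn.congr_fun (?_ : IntegrableOn (fun x : ℝ => |b| ^ (a + 1)
      * ((1 - Real.cos (|b| * x)) * (|b| * x) ^ (-a - 1))) (Set.Ioi 0))
      (fun x hx => (one_sub_cos_mul_rpow_scale a hb hx).symm) measurableSet_Ioi)
    refine Integrable.const_mul ?_ _
    have := (integrableOn_Ioi_comp_mul_left_iff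
      (fun x : ℝ => (1 - Real.cos x) * x ^ (-a - 1)) 0 hb').2
      (by simpa using integrableOn_one_sub_cos_mul_rpow h0 h2)
    exact this

theorem integral_one_sub_cos_mul_mul_rpow {a : ℝ} (h0 : 0 < a) (h2 : a < 2) (b : ℝ) :
    ∫ x in Set.Ioi (0 : ℝ), (1 - Real.cos (b * x)) * x ^ (-a - 1)
      = |b| ^ a * (π / (2 * Real.Gamma (a + 1) * Real.sin (π * (a / 2)))) := by
  rcases eq_or_ne b 0 with rfl | hb
  · simp [Real.zero_rpow h0.ne']
  · have hb' : 0 < |b| := abs_pos.2 hb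
    rw [setIntegral_congr_fun measurableSet_Ioi
      (fun x hx => one_sub_cos_mul_rpow_scale a hb hx), MeasureTheory.integral_const_mul,
      integral_comp_mul_left_Ioi (fun x : ℝ => (1 - Real.cos x) * x ^ (-a - 1)) 0 hb',
      mul_zero, integral_one_sub_cos_mul_rpow h0 h2, smul_eq_mul, ← mul_assoc, Real.rpow_add_one hb'.ne']
    field_simp

/-- The integral of `(1 - cos x) x ^ (-a - 1)` over the half-line. -/
noncomputable def oneSubCosMellin (a : ℝ) : ℝ :=
  π / (2 * Real.Gamma (a + 1) * Real.sin (π * (a / 2)))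

theorem oneSubCosMellin_pos {a : ℝ} (h0 : 0 < a) (h2 : a < 2) : 0 < oneSubCosMellin a := by
  have hG : 0 < Real.Gamma (a + 1) := Real.Gamma_pos_of_pos (by linarith)
  have hs := sin_pi_mul_half_pos h0 h2
  unfold oneSubCosMellin; positivity

/-- The spectral density of the continuous-time increment process, up to a constant. -/
noncomputable def lineDensity (a x : ℝ) : ℝ := 4 * Real.sin (π * x) ^ 2 * |x| ^ (-a - 1)

theorem lineDensity_nonneg (a x : ℝ) : 0 ≤ lineDensity a x := by unfold lineDensity; positivity

@[fun_prop]
theorem measurable_lineDensity (a : ℝ) : Measurable (lineDensity a) := by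
  unfold lineDensity; fun_prop

theorem lineDensity_mul_cos_eq (a : ℝ) (k : ℤ) (x : ℝ) :
    lineDensity a x * Real.cos (2 * π * k * x)
      = (fun y : ℝ => -2 * ((1 - Real.cos (2 * π * k * y)) * y ^ (-a - 1))
          + (1 - Real.cos (2 * π * (k + 1) * y)) * y ^ (-a - 1)
          + (1 - Real.cos (2 * π * (k - 1) * y)) * y ^ (-a - 1)) |x| := by
  have hc : ∀ b : ℝ, Real.cos (b * |x|) = Real.cos (b * x) := by
    intro b
    rcases abs_cases x with ⟨h, _⟩ | ⟨h, _⟩ <;> simp [h]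
  have h1 : Real.cos (2 * π * (k + 1) * x) = Real.cos (2 * π * k * x + 2 * (π * x)) := by
    congr 1; ring
  have h2 : Real.cos (2 * π * (k - 1) * x) = Real.cos (2 * π * k * x - 2 * (π * x)) := by
    congr 1; ring
  simp only [hc, lineDensity]
  rw [h1, h2, Real.cos_add, Real.cos_sub, Real.cos_two_mul (π * x)]
  linear_combination (4 * |x| ^ (-a - 1) * Real.cos (2 * π * k * x))
    * (Real.sin_sq_add_cos_sq (π * x))

theorem integral_lineDensity_mul_cos {a : ℝ} (h0 : 0 < a) (h2 : a < 2) (k : ℤ) :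
    ∫ x, lineDensity a x * Real.cos (2 * π * k * x)
      = 2 * oneSubCosMellin a * (2 * π) ^ a
        * (|(k : ℝ) + 1| ^ a - 2 * |(k : ℝ)| ^ a + |(k : ℝ) - 1| ^ a) := by
  have hi := integrableOn_one_sub_cos_mul_mul_rpow h0 h2
  have hp : (0 : ℝ) ≤ 2 * π := by positivity
  have hs : ∀ t : ℝ, |2 * π * t| ^ a = (2 * π) ^ a * |t| ^ a := by
    intro t
    rw [abs_mul, abs_of_nonneg hp, Real.mul_rpow hp (abs_nonneg t)]
  simp only [lineDensity_mul_cos_eq]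
  refine (integral_comp_abs (f := fun y : ℝ => -2 * ((1 - Real.cos (2 * π * k * y)) * y ^ (-a - 1))
    + (1 - Real.cos (2 * π * (k + 1) * y)) * y ^ (-a - 1)
    + (1 - Real.cos (2 * π * (k - 1) * y)) * y ^ (-a - 1))).trans ?_
  rw [MeasureTheory.integral_add (f := fun y : ℝ => -2 * ((1 - Real.cos (2 * π * k * y)) * y ^ (-a - 1))
      + (1 - Real.cos (2 * π * (k + 1) * y)) * y ^ (-a - 1))
      (((hi _).const_mul _).add (hi _)) (hi _),
    MeasureTheory.integral_add ((hi _).const_mul _) (hi _), MeasureTheory.integral_const_mul,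
    integral_one_sub_cos_mul_mul_rpow h0 h2, integral_one_sub_cos_mul_mul_rpow h0 h2,
    integral_one_sub_cos_mul_mul_rpow h0 h2, hs, hs, hs, oneSubCosMellin]
  ring

theorem integral_lineDensity {a : ℝ} (h0 : 0 < a) (h2 : a < 2) :
    ∫ x, lineDensity a x = 4 * oneSubCosMellin a * (2 * π) ^ a := by
  have := integral_lineDensity_mul_cos h0 h2 0
  simp only [Int.cast_zero, mul_zero, zero_mul, Real.cos_zero, mul_one, zero_add, abs_one,
    Real.one_rpow, abs_zero, Real.zero_rpow h0.ne', zero_sub, abs_neg] at this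
  rw [this]; ring

theorem integrable_lineDensity {a : ℝ} (h0 : 0 < a) (h2 : a < 2) : Integrable (lineDensity a) := by
  have := oneSubCosMellin_pos h0 h2
  refine Integrable.of_integral_ne_zero ?_
  rw [integral_lineDensity h0 h2]
  positivity

theorem integrable_lineDensity_mul_cos {a : ℝ} (h0 : 0 < a) (h2 : a < 2) (k : ℤ) :
    Integrable fun x => lineDensity a x * Real.cos (2 * π * k * x) := by
  refine (integrable_lineDensity h0 h2).mono' (by fun_prop)
    (Filter.Eventually.of_forall fun x => ?_)
  rw [norm_mul, Real.norm_of_nonneg (lineDensity_nonneg a x)]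
  exact mul_le_of_le_one_right (lineDensity_nonneg a x) (Real.abs_cos_le_one _)

theorem lineDensity_add_int (a μ : ℝ) (n : ℤ) :
    lineDensity a (μ + n) = 4 * Real.sin (π * μ) ^ 2 * |μ + n| ^ (-a - 1) := by
  have : Real.sin (π * (μ + n)) ^ 2 = Real.sin (π * μ) ^ 2 := by
    rw [mul_add, mul_comm π (n : ℝ), Real.sin_add_int_mul_pi, mul_pow, ← zpow_natCast ((-1 : ℝ) ^ n) 2,
      ← _root_.zpow_mul, mul_comm n,
      _root_.zpow_mul]
    simp
  rw [lineDensity, this]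

theorem summable_abs_add_int_rpow {a : ℝ} (h0 : 0 < a) (μ : ℝ) :
    Summable fun n : ℤ => |μ + (n : ℝ)| ^ (-a - 1) := by
  refine ((Real.summable_one_div_int_add_rpow μ (a + 1)).2 (by linarith)).congr fun n => ?_
  rw [show -a - 1 = -(a + 1) by ring, Real.rpow_neg (abs_nonneg _), one_div, add_comm]

/-- The sum `∑ₖ |μ + k| ^ (-a - 1)` over the integers. -/
noncomputable def latticeSum (a μ : ℝ) : ℝ := ∑' n : ℤ, |μ + (n : ℝ)| ^ (-a - 1)

theorem latticeSum_nonneg (a μ : ℝ) : 0 ≤ latticeSum a μ :=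
  tsum_nonneg fun _ => Real.rpow_nonneg (abs_nonneg _) _

theorem latticeSum_neg (a μ : ℝ) : latticeSum a (-μ) = latticeSum a μ := by
  unfold latticeSum
  rw [← (Equiv.neg ℤ).tsum_eq]
  refine tsum_congr fun n => ?_
  rw [Equiv.neg_apply, Int.cast_neg, ← neg_add, abs_neg]

theorem latticeSum_add_one (a μ : ℝ) : latticeSum a (μ + 1) = latticeSum a μ := by
  unfold latticeSum
  rw [← (Equiv.addRight (1 : ℤ)).tsum_eq fun n : ℤ => |μ + (n : ℝ)| ^ (-a - 1)]
  refine tsum_congr fun n => ?_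
  simp only [Equiv.coe_addRight, Int.cast_add, Int.cast_one]
  congr 2; ring

theorem one_le_latticeSum {a μ : ℝ} (h0 : 0 < a) (hμ0 : μ ≠ 0) (hμ : |μ| ≤ 1) :
    1 ≤ latticeSum a μ := by
  have h := (summable_abs_add_int_rpow h0 μ).le_tsum (0 : ℤ)
    fun n _ => Real.rpow_nonneg (abs_nonneg _) _
  refine le_trans ?_ h
  simp only [Int.cast_zero, add_zero]
  exact Real.one_le_rpow_of_pos_of_le_one_of_nonpos (abs_pos.2 hμ0) hμ (by linarith)

/-- The spectral density of unit-variance fractional Gaussian noise with Hurst index `a / 2`. -/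
noncomputable def fgnDensity (a μ : ℝ) : ℝ :=
  (4 * oneSubCosMellin a * (2 * π) ^ a)⁻¹ * (4 * Real.sin (π * μ) ^ 2) * latticeSum a μ

theorem fgnDensity_eq_tsum (a μ : ℝ) :
    fgnDensity a μ = (4 * oneSubCosMellin a * (2 * π) ^ a)⁻¹ * ∑' n : ℤ, lineDensity a (μ + n) := by
  simp only [lineDensity_add_int, tsum_mul_left, fgnDensity, latticeSum, mul_assoc]

theorem measurable_fgnDensity {a : ℝ} : Measurable (fgnDensity a) := by
  simp only [funext (fgnDensity_eq_tsum a)]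
  refine Measurable.const_mul ?_ _
  refine Measurable.tsum ?_
  fun_prop

theorem fgnDensity_nonneg {a : ℝ} (h0 : 0 < a) (h2 : a < 2) (μ : ℝ) : 0 ≤ fgnDensity a μ := by
  have := oneSubCosMellin_pos h0 h2
  have := latticeSum_nonneg a μ
  unfold fgnDensity; positivity

theorem fgnDensity_neg (a μ : ℝ) : fgnDensity a (-μ) = fgnDensity a μ := by
  simp [fgnDensity, latticeSum_neg]

theorem fgnDensity_periodic (a : ℝ) : Function.Periodic (fgnDensity a) 1 := by
  intro μ
  have : Real.sin (π * (μ + 1)) ^ 2 = Real.sin (π * μ) ^ 2 := by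
    rw [mul_add, mul_one, Real.sin_add_pi, neg_sq]
  simp only [fgnDensity, latticeSum_add_one, this]

theorem integral_fgnDensity_mul_cos {a : ℝ} (h0 : 0 < a) (h2 : a < 2) (k : ℤ) :
    ∫ μ in (0 : ℝ)..1, fgnDensity a μ * Real.cos (2 * π * k * μ)
      = (|(k : ℝ) + 1| ^ a - 2 * |(k : ℝ)| ^ a + |(k : ℝ) - 1| ^ a) / 2 := by
  have hcos : ∀ (μ : ℝ) (n : ℤ), Real.cos (2 * π * k * (μ + n)) = Real.cos (2 * π * k * μ) := by
    intro μ n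
    rw [show 2 * π * k * (μ + n) = 2 * π * k * μ + ((k * n : ℤ) : ℝ) * (2 * π) by push_cast; ring,
      Real.cos_add_int_mul_two_pi]
  have hC := oneSubCosMellin_pos h0 h2
  have e : ∀ μ : ℝ, fgnDensity a μ * Real.cos (2 * π * k * μ)
      = (4 * oneSubCosMellin a * (2 * π) ^ a)⁻¹
        * ∑' n : ℤ, lineDensity a (μ + n) * Real.cos (2 * π * k * (μ + n)) := by
    intro μ
    simp only [hcos, tsum_mul_right, fgnDensity_eq_tsum]
    ring
  have h1 := (integrable_lineDensity_mul_cos h0 h2 k).hasSum_intervalIntegral_comp_add_int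
  have h1' := (integrable_lineDensity h0 h2).hasSum_intervalIntegral_comp_add_int
  simp only [intervalIntegral.integral_of_le zero_le_one] at h1 h1' ⊢
  have h3 : HasSum _ _ := hasSum_integral_of_summable_integral_norm
    (μ := volume.restrict (Set.Ioc (0 : ℝ) 1))
    (F := fun (n : ℤ) (μ : ℝ) => lineDensity a (μ + n) * Real.cos (2 * π * k * (μ + n)))
    (fun n => ((integrable_lineDensity_mul_cos h0 h2 k).comp_add_right (n : ℝ)).integrableOn)
    (by
      refine h1'.summable.of_nonneg_of_le (fun n => integral_nonneg fun _ => norm_nonneg _) fun n => ?_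
      refine integral_mono ((integrable_lineDensity_mul_cos h0 h2 k).comp_add_right
        (n : ℝ)).integrableOn.norm
        ((integrable_lineDensity h0 h2).comp_add_right (n : ℝ)).integrableOn fun μ => ?_
      simp only [norm_mul, Real.norm_of_nonneg (lineDensity_nonneg a (μ + n))]
      exact mul_le_of_le_one_right (lineDensity_nonneg a _) (Real.abs_cos_le_one _))
  simp only [e, MeasureTheory.integral_const_mul]
  rw [h3.unique h1, integral_lineDensity_mul_cos h0 h2]
  field_simp
  ring

theorem log_fgnDensity_eq {a μ : ℝ} (h0 : 0 < a) (h2 : a < 2) (hμ0 : μ ≠ 0) (hμ : |μ| ≤ 1 / 2) :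
    Real.log (fgnDensity a μ) = (-Real.log (oneSubCosMellin a * (2 * π) ^ a)
      + 2 * Real.log (Real.sin (π * μ))) + Real.log (latticeSum a μ) := by
  have hC := oneSubCosMellin_pos h0 h2
  have hS := one_le_latticeSum h0 hμ0 (hμ.trans (by norm_num))
  have hs : Real.sin (π * μ) ≠ 0 := by
    rw [abs_le] at hμ
    refine fun h => hμ0 ?_
    have := (Real.sin_eq_zero_iff_of_lt_of_lt (by nlinarith [Real.pi_pos])
      (by nlinarith [Real.pi_pos])).1 h
    exact (mul_eq_zero.1 this).resolve_left Real.pi_ne_zero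
  have e : fgnDensity a μ = (oneSubCosMellin a * (2 * π) ^ a)⁻¹ * Real.sin (π * μ) ^ 2
      * latticeSum a μ := by
    unfold fgnDensity; field_simp
  rw [e, Real.log_mul (by positivity) (by positivity), Real.log_mul (by positivity) (by positivity),
    Real.log_inv, Real.log_pow]
  norm_num

theorem intervalIntegrable_fgnDensity {a : ℝ} (h0 : 0 < a) (h2 : a < 2) (u v : ℝ) :
    IntervalIntegrable (fgnDensity a) volume u v := by
  refine (fgnDensity_periodic a).intervalIntegrable₀ one_ne_zero ?_ u v
  refine intervalIntegrable_of_integral_ne_zero ?_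
  have := integral_fgnDensity_mul_cos h0 h2 0
  simp only [Int.cast_zero, mul_zero, zero_mul, Real.cos_zero, mul_one, zero_add, abs_one,
    Real.one_rpow, abs_zero, Real.zero_rpow h0.ne', zero_sub, abs_neg] at this
  rw [this]; norm_num

theorem intervalIntegrable_log_sin_pi_mul (u v : ℝ) :
    IntervalIntegrable (fun μ => Real.log (Real.sin (π * μ))) volume u v := by
  have := (intervalIntegrable_log_sin (a := π * u) (b := π * v)).comp_mul_left (c := π)
  simpa [Real.pi_ne_zero] using this

theorem integral_log_sin_pi_mul :
    ∫ μ in (-(1 : ℝ) / 2)..(1 / 2), Real.log (Real.sin (π * μ)) = -Real.log 2 := by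
  have hp : Function.Periodic (fun μ => Real.log (Real.sin (π * μ))) 1 := by
    intro μ
    simp only [mul_add, mul_one, Real.sin_add_pi, Real.log_neg_eq_log]
  have h1 := hp.intervalIntegral_add_eq (-(1 : ℝ) / 2) 0
  rw [show -(1 : ℝ) / 2 + 1 = 1 / 2 by norm_num, zero_add] at h1
  rw [h1, integral_comp_mul_left (fun x => Real.log (Real.sin x)) Real.pi_ne_zero, mul_zero, mul_one,
    integral_log_sin_zero_pi, smul_eq_mul]
  field_simp

theorem ae_restrict_ne_zero_and_abs_le :
    ∀ᵐ μ : ℝ ∂(volume.restrict (Set.uIoc (-(1 : ℝ) / 2) (1 / 2))), μ ≠ 0 ∧ |μ| ≤ 1 / 2 := by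
  rw [Set.uIoc_of_le (by norm_num)]
  filter_upwards [ae_restrict_mem measurableSet_Ioc, (Measure.ae_ne (volume : Measure ℝ) 0).filter_mono
    (ae_mono Measure.restrict_le_self)] with μ hμ h
  exact ⟨h, abs_le.2 ⟨by linarith [hμ.1], hμ.2⟩⟩

theorem intervalIntegrable_log_fgnDensity {a : ℝ} (h0 : 0 < a) (h2 : a < 2) :
    IntervalIntegrable (fun μ => Real.log (fgnDensity a μ)) volume (-(1 : ℝ) / 2) (1 / 2) := by
  have hL : IntervalIntegrable (fun μ => -Real.log (oneSubCosMellin a * (2 * π) ^ a)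
      + 2 * Real.log (Real.sin (π * μ))) volume (-(1 : ℝ) / 2) (1 / 2) :=
    intervalIntegrable_const.add ((intervalIntegrable_log_sin_pi_mul _ _).const_mul 2)
  refine (hL.norm.add (intervalIntegrable_fgnDensity h0 h2 _ _)).mono_fun'
    measurable_fgnDensity.log.aestronglyMeasurable ?_
  filter_upwards [ae_restrict_ne_zero_and_abs_le] with μ ⟨hμ0, hμ⟩
  have hS := Real.log_nonneg (one_le_latticeSum h0 hμ0 (hμ.trans (by norm_num)))
  have hF := fgnDensity_nonneg h0 h2 μ
  have h1 := log_fgnDensity_eq h0 h2 hμ0 hμ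
  have h3 := Real.log_le_self hF
  rw [Real.norm_eq_abs, abs_le]
  constructor
  · have := neg_abs_le (-Real.log (oneSubCosMellin a * (2 * π) ^ a)
      + 2 * Real.log (Real.sin (π * μ)))
    simp only [Real.norm_eq_abs]
    linarith
  · linarith [norm_nonneg (-Real.log (oneSubCosMellin a * (2 * π) ^ a)
      + 2 * Real.log (Real.sin (π * μ)))]

theorem integral_log_fgnDensity {a : ℝ} (h0 : 0 < a) (h2 : a < 2) :
    ∫ μ in (-(1 : ℝ) / 2)..(1 / 2), Real.log (fgnDensity a μ)
      = Real.log (Real.sin (π * (a / 2)) * Real.Gamma (a + 1)) - (a + 1) * Real.log (2 * π)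
        + ∫ μ in (-(1 : ℝ) / 2)..(1 / 2), Real.log (latticeSum a μ) := by
  have hs := sin_pi_mul_half_pos h0 h2
  have hG : 0 < Real.Gamma (a + 1) := Real.Gamma_pos_of_pos (by linarith)
  have hsin := (intervalIntegrable_log_sin_pi_mul (-(1 : ℝ) / 2) (1 / 2)).const_mul 2
  have hL : IntervalIntegrable (fun μ => -Real.log (oneSubCosMellin a * (2 * π) ^ a)
      + 2 * Real.log (Real.sin (π * μ))) volume (-(1 : ℝ) / 2) (1 / 2) :=
    intervalIntegrable_const.add hsin
  have hae : ∀ᵐ μ : ℝ, μ ∈ Set.uIoc (-(1 : ℝ) / 2) (1 / 2) → Real.log (latticeSum a μ)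
      = Real.log (fgnDensity a μ) - (-Real.log (oneSubCosMellin a * (2 * π) ^ a)
        + 2 * Real.log (Real.sin (π * μ))) := by
    refine (ae_restrict_iff' measurableSet_uIoc).1 ?_
    filter_upwards [ae_restrict_ne_zero_and_abs_le] with μ ⟨hμ0, hμ⟩
    linarith [log_fgnDensity_eq h0 h2 hμ0 hμ]
  have hC : Real.log (oneSubCosMellin a * (2 * π) ^ a) = -Real.log (Real.sin (π * (a / 2))
      * Real.Gamma (a + 1)) + (a + 1) * Real.log (2 * π) - 2 * Real.log 2 := by
    have h2π : 0 < 2 * π := by positivity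
    have e : oneSubCosMellin a * (2 * π) ^ a
        = (Real.sin (π * (a / 2)) * Real.Gamma (a + 1))⁻¹ * (2 * π) ^ (a + 1) * (2 ^ 2)⁻¹ := by
      rw [oneSubCosMellin, Real.rpow_add_one h2π.ne']
      field_simp
    rw [e, Real.log_mul (by positivity) (by positivity), Real.log_mul (by positivity) (by positivity),
      Real.log_inv, Real.log_inv, Real.log_pow, Real.log_rpow h2π]
    push_cast
    ring
  rw [integral_congr_ae hae, intervalIntegral.integral_sub (intervalIntegrable_log_fgnDensity h0 h2) hL,
    intervalIntegral.integral_add intervalIntegrable_const hsin, intervalIntegral.integral_const_mul,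
    integral_log_sin_pi_mul, intervalIntegral.integral_const, hC]
  norm_num
  ring

/-- The spectral density of fractional Gaussian noise as a function on the unit circle. -/
noncomputable def fgnSymbol (a : ℝ) : UnitAddCircle → ℝ := (fgnDensity_periodic a).lift

theorem fgnSymbol_coe (a μ : ℝ) : fgnSymbol a (μ : UnitAddCircle) = fgnDensity a μ :=
  Function.Periodic.lift_coe _ _

theorem fgnSymbol_neg (a : ℝ) (x : UnitAddCircle) : fgnSymbol a (-x) = fgnSymbol a x := by
  induction x using QuotientAddGroup.induction_on with
  | H μ => exact (fgnSymbol_coe a (-μ)).trans ((fgnDensity_neg a μ).trans (fgnSymbol_coe a μ).symm)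

theorem integrable_fgnSymbol {a : ℝ} (h0 : 0 < a) (h2 : a < 2) : Integrable (fgnSymbol a) := by
  rw [integrable_unitAddCircle_iff 0]
  simp only [fgnSymbol_coe]
  exact intervalIntegrable_fgnDensity h0 h2 _ _

theorem integrable_log_fgnSymbol {a : ℝ} (h0 : 0 < a) (h2 : a < 2) :
    Integrable fun x => Real.log (fgnSymbol a x) := by
  rw [integrable_unitAddCircle_iff (-(1 : ℝ) / 2)]
  simp only [fgnSymbol_coe]
  convert intervalIntegrable_log_fgnDensity h0 h2 using 1
  norm_num

theorem integral_log_fgnSymbol (a : ℝ) :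
    ∫ x, Real.log (fgnSymbol a x) = ∫ μ in (-(1 : ℝ) / 2)..(1 / 2), Real.log (fgnDensity a μ) := by
  rw [← UnitAddCircle.intervalIntegral_preimage (-(1 : ℝ) / 2)]
  simp only [fgnSymbol_coe]
  norm_num

theorem fgnSymbol_pos_ae {a : ℝ} (h0 : 0 < a) (h2 : a < 2) :
    ∀ᵐ x : UnitAddCircle, 0 < fgnSymbol a x := by
  filter_upwards [Measure.ae_ne (volume : Measure UnitAddCircle) 0] with x hx
  obtain ⟨μ, hμ, rfl⟩ := (AddCircle.coe_image_Ico_eq (1 : ℝ) 0).symm ▸ Set.mem_univ x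
  rw [zero_add] at hμ
  have hμ0 : 0 < μ := hμ.1.lt_of_ne (by rintro rfl; exact hx rfl)
  have hC := oneSubCosMellin_pos h0 h2
  have hS := one_le_latticeSum h0 hμ0.ne' (abs_le.2 ⟨by linarith, hμ.2.le⟩)
  have hs : 0 < Real.sin (π * μ) :=
    Real.sin_pos_of_pos_of_lt_pi (by positivity) (by nlinarith [Real.pi_pos, hμ.2])
  rw [fgnSymbol_coe, fgnDensity]
  positivity

theorem circleToeplitz_fgnSymbol {a : ℝ} (h0 : 0 < a) (h2 : a < 2) (n : ℕ) :
    circleToeplitz (fgnSymbol a) n = Matrix.of fun i j : Fin n =>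
      (|(((i : ℤ) - (j : ℤ) : ℤ) : ℝ) + 1| ^ a - 2 * |(((i : ℤ) - (j : ℤ) : ℤ) : ℝ)| ^ a
        + |(((i : ℤ) - (j : ℤ) : ℤ) : ℝ) - 1| ^ a) / 2 := by
  ext i j
  rw [circleToeplitz, Matrix.of_apply, Matrix.of_apply, ← integral_fgnDensity_mul_cos h0 h2,
    ← UnitAddCircle.intervalIntegral_preimage 0, zero_add]
  refine intervalIntegral.integral_congr fun μ _ => ?_
  simp only [fgnSymbol_coe, fourier_coe_apply]
  congr 1
  rw [← Complex.exp_ofReal_mul_I_re]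
  congr 2
  push_cast
  ring

end SpectralRepresentation

theorem fgnRho_natAbs {H : ℝ} (hH : 0 < H) (k : ℤ) :
    fgnRho H k.natAbs
      = (|(k : ℝ) + 1| ^ (2 * H) - 2 * |(k : ℝ)| ^ (2 * H) + |(k : ℝ) - 1| ^ (2 * H)) / 2 := by
  have hH' : 2 * H ≠ 0 := by positivity
  unfold fgnRho
  rcases eq_or_ne k 0 with rfl | hk
  · simp [Real.zero_rpow hH']
  · have hk' : k.natAbs ≠ 0 := Int.natAbs_ne_zero.2 hk
    rw [if_neg hk', Nat.cast_natAbs, Int.cast_abs]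
    rcases hk.lt_or_gt with h | h
    · have : (k : ℝ) ≤ -1 := by exact_mod_cast Int.le_sub_one_of_lt h
      rw [abs_of_nonpos (by linarith : (k : ℝ) ≤ 0), abs_of_nonpos (by linarith : (k : ℝ) + 1 ≤ 0),
        abs_of_nonpos (by linarith : (k : ℝ) - 1 ≤ 0),
        show -(k : ℝ) + 1 = -(k - 1) by ring, show -(k : ℝ) - 1 = -(k + 1) by ring]
      ring
    · have : (1 : ℝ) ≤ k := by exact_mod_cast h
      rw [abs_of_nonneg (by linarith : (0 : ℝ) ≤ k), abs_of_nonneg (by linarith : 0 ≤ (k : ℝ) + 1),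
        abs_of_nonneg (by linarith : 0 ≤ (k : ℝ) - 1)]

theorem fgnCov_eq_circleToeplitz {H : ℝ} (hH : H ∈ Set.Ioo (0 : ℝ) 1) (n : ℕ) :
    fgnCov H n = circleToeplitz (fgnSymbol (2 * H)) n := by
  rw [circleToeplitz_fgnSymbol (by linarith [hH.1]) (by linarith [hH.2])]
  ext i j
  rw [fgnCov, Matrix.of_apply, Matrix.of_apply, ← fgnRho_natAbs hH.1]
  congr 1
  unfold Nat.dist
  omega

/-- Spectral-density formula for the entropy rate of fractional Gaussian noise:
`lim (1/n) log det Σ_n(H)` equals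
`log(sin(πH) Γ(2H+1)) − (2H+1) log(2π) + ∫_{−1/2}^{1/2} log(Σ_{k∈ℤ} |μ+k|^{−2H−1}) dμ`,
and equivalently the entropy rate equals
`(1/2)(1 + log(sin(πH) Γ(2H+1) (2π)^{−2H})) + (1/2) ∫_{−1/2}^{1/2} log(Σ_{k∈ℤ} |μ+k|^{−2H−1}) dμ`. -/
theorem fgn_entropy_rate_spectral (H : ℝ) (hH : H ∈ Set.Ioo (0 : ℝ) 1) :
    Filter.Tendsto (fun n : ℕ => Real.log (fgnCov H n).det / (n : ℝ)) Filter.atTop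
      (nhds (Real.log (Real.sin (π * H) * Real.Gamma (2 * H + 1))
        - (2 * H + 1) * Real.log (2 * π)
        + ∫ μ in (-(1 : ℝ)/2)..(1/2),
            Real.log (∑' k : ℤ, |μ + (k : ℝ)| ^ (-(2 * H) - 1)))) ∧
    Filter.Tendsto (fun n : ℕ =>
        (((n : ℝ) / 2) * (1 + Real.log (2 * π))
          + (1 / 2) * Real.log (fgnCov H n).det) / (n : ℝ)) Filter.atTop
      (nhds ((1 / 2) * (1 + Real.log (Real.sin (π * H) * Real.Gamma (2 * H + 1)
            * (2 * π) ^ (-(2 * H))))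
        + (1 / 2) * ∫ μ in (-(1 : ℝ)/2)..(1/2),
            Real.log (∑' k : ℤ, |μ + (k : ℝ)| ^ (-(2 * H) - 1)))) := by
  have hH0 := hH.1
  have hH1 := hH.2
  have h0 : 0 < 2 * H := by linarith
  have h2 : 2 * H < 2 := by linarith
  have hG : 0 < Real.Gamma (2 * H + 1) := Real.Gamma_pos_of_pos (by linarith)
  have hs := sin_pi_mul_half_pos h0 h2
  have key := tendsto_log_det_circleToeplitz_div (integrable_fgnSymbol h0 h2)
    (fgnSymbol_pos_ae h0 h2) (integrable_log_fgnSymbol h0 h2) (fgnSymbol_neg _)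
  rw [integral_log_fgnSymbol, integral_log_fgnDensity h0 h2] at key
  rw [show 2 * H / 2 = H by ring] at hs key
  simp only [← fgnCov_eq_circleToeplitz hH, latticeSum] at key
  refine ⟨key, ?_⟩
  have h := (key.const_mul (1 / 2)).const_add (1 / 2 * (1 + Real.log (2 * π)))
  have hlim : ∀ I : ℝ, 1 / 2 * (1 + Real.log (2 * π)) + 1 / 2 * (Real.log (Real.sin (π * H)
      * Real.Gamma (2 * H + 1)) - (2 * H + 1) * Real.log (2 * π) + I)
      = 1 / 2 * (1 + Real.log (Real.sin (π * H) * Real.Gamma (2 * H + 1) * (2 * π) ^ (-(2 * H))))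
        + 1 / 2 * I := by
    intro I
    rw [Real.log_mul (y := (2 * π) ^ (-(2 * H))) (by positivity) (by positivity),
      Real.log_rpow (by positivity)]
    ring
  rw [hlim] at h
  refine h.congr' ?_
  filter_upwards [Filter.eventually_gt_atTop 0] with n hn
  have : (n : ℝ) ≠ 0 := by positivity
  field_simp
end
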